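/- arXiv:2306.10393 — 4 statements merged into one kernel-verified Lean document; each statement's English description precedes it below -/
import Mathlib

section
/- With the standing setup (prime p, l_p, B, Ψ_B, 𝒵_B, b_max, θ_max, A_1(B), A_2(B), P_B, I, odd s, n ∈ I, and the rational function R_n), fix θ ∈ 𝒵_B. Then there is a sequence (u_k)_{k≥0} of rational numbers such that for every t ∈ ℤ_p the series Σ_{k≥0} u_k t^k converges in ℚ_p to R_n(t+θ), the power series has radius of convergence strictly greater than 1 (indeed |u_k|_p · p^{l_p k} is bounded), and for every integer k ≥ 0 one has v_p(u_k) ≥ (l_p + 1/(p−1))·s·n − (log(n+1)/log p)·(s − |𝒵_B|) + l_p·(s + k). -/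
/-- The integer `l_p`: `1` if `p ≥ 5`, `2` if `p = 3`, `3` if `p = 2`. -/
def ellp (p : ℕ) : ℕ := if 5 ≤ p then 1 else if p = 3 then 2 else 3

/-- `d_n = lcm(1, 2, …, n)`. -/
def dd (n : ℕ) : ℕ := (Finset.Icc 1 n).lcm id

/-- The rational function
`R_n(t) = A₁(B)^n A₂(B)^n (n!^{s-|𝒵|+1}/(θ_max n - 1)!) (t+θ_max)_{θ_max n-1}
  ∏_{θ ∈ 𝒵∖{θ_max}} (t+θ)_n / ((t)_{n+1})^s`,
where `Ψ = Ψ_B`, `Z = 𝒵_B`, `θ_max = (p^{l_p} b_max - 1)/(p^{l_p} b_max)` and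
Pochhammer symbols are written as products. -/
noncomputable def Rfun (p : ℕ) (Ψ : Finset ℕ) (Z : Finset ℚ) (bmax s n : ℕ) (t : ℚ) : ℚ :=
  let Nb : ℕ := p ^ ellp p * bmax
  let m : ℕ := (Nb - 1) * n / Nb
  let θmax : ℚ := ((Nb : ℚ) - 1) / (Nb : ℚ)
  let A1 : ℕ := ∏ b ∈ Ψ, (p ^ ellp p * b) ^ (p ^ ellp p * b).totient
  let A2 : ℕ := ∏ b ∈ Ψ, ∏ q ∈ (p ^ ellp p * b).primeFactors,
    q ^ ((p ^ ellp p * b).totient / (q - 1))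
  (A1 : ℚ) ^ n * (A2 : ℚ) ^ n *
    ((Nat.factorial n : ℚ) ^ (s - Z.card + 1) / (Nat.factorial (m - 1) : ℚ)) *
    (∏ j ∈ Finset.range (m - 1), (t + θmax + (j : ℚ))) *
    (∏ θ ∈ Z.erase θmax, ∏ j ∈ Finset.range n, (t + θ + (j : ℚ))) /
    (∏ j ∈ Finset.range (n + 1), (t + (j : ℚ))) ^ s

/-- The rational function `R_n`, viewed as a function on `ℚ_p`
(same formula as `Rfun`, with all rational constants embedded in `ℚ_p`). -/
noncomputable def RfunP (p : ℕ) [Fact p.Prime] (Ψ : Finset ℕ) (Z : Finset ℚ)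
    (bmax s n : ℕ) (t : ℚ_[p]) : ℚ_[p] :=
  let Nb : ℕ := p ^ ellp p * bmax
  let m : ℕ := (Nb - 1) * n / Nb
  let θmax : ℚ := ((Nb : ℚ) - 1) / (Nb : ℚ)
  let A1 : ℕ := ∏ b ∈ Ψ, (p ^ ellp p * b) ^ (p ^ ellp p * b).totient
  let A2 : ℕ := ∏ b ∈ Ψ, ∏ q ∈ (p ^ ellp p * b).primeFactors,
    q ^ ((p ^ ellp p * b).totient / (q - 1))
  (A1 : ℚ_[p]) ^ n * (A2 : ℚ_[p]) ^ n *
    ((Nat.factorial n : ℚ_[p]) ^ (s - Z.card + 1) / (Nat.factorial (m - 1) : ℚ_[p])) *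
    (∏ j ∈ Finset.range (m - 1), (t + (θmax : ℚ_[p]) + (j : ℚ_[p]))) *
    (∏ θ ∈ Z.erase θmax, ∏ j ∈ Finset.range n, (t + (θ : ℚ_[p]) + (j : ℚ_[p]))) /
    (∏ j ∈ Finset.range (n + 1), (t + (j : ℚ_[p]))) ^ s

/-- `F` on `ℤ_p` is given by a rational power series with weighted valuation at least `w`. -/
def GoodSeries (p : ℕ) [Fact p.Prime] (l : ℕ) (w : ℤ) (F : ℤ_[p] → ℚ_[p]) : Prop :=
  ∃ u : PowerSeries ℚ, (∀ k : ℕ, ‖((PowerSeries.coeff k u : ℚ) : ℚ_[p])‖ ≤ (p : ℝ) ^ (-(w + l * k))) ∧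
    ∀ t : ℤ_[p], HasSum (fun k : ℕ => ((PowerSeries.coeff k u : ℚ) : ℚ_[p]) * (t : ℚ_[p]) ^ k) (F t)

section good
variable {p : ℕ} [hp : Fact p.Prime] {l : ℕ}

lemma p_pos_real : (0 : ℝ) < p := by exact_mod_cast hp.out.pos
lemma p_one_lt_real : (1 : ℝ) < p := by exact_mod_cast hp.out.one_lt

lemma hasSum_congr_fun {f g : ℕ → ℚ_[p]} {a : ℚ_[p]} (h : HasSum g a) (e : ∀ k, f k = g k) :
    HasSum f a := by
  have : f = g := funext e
  rw [this]
  exact h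

lemma good_summable (hl : 1 ≤ l) {w : ℤ} {u : PowerSeries ℚ}
    (h : ∀ k : ℕ, ‖((PowerSeries.coeff k u : ℚ) : ℚ_[p])‖ ≤ (p : ℝ) ^ (-(w + l * k))) (t : ℤ_[p]) :
    Summable (fun k : ℕ => ‖((PowerSeries.coeff k u : ℚ) : ℚ_[p]) * (t : ℚ_[p]) ^ k‖) := by
  have hp0 : (0 : ℝ) < p := p_pos_real
  have hp1 : (1 : ℝ) < p := p_one_lt_real
  have hs : Summable (fun k : ℕ => (p : ℝ) ^ (-w) * ((p : ℝ) ^ (-(l : ℤ))) ^ k) := by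
    apply Summable.mul_left
    apply summable_geometric_of_lt_one (by positivity)
    apply zpow_lt_one_of_neg₀ hp1
    omega
  refine Summable.of_nonneg_of_le (fun _ => norm_nonneg _) (fun k => ?_) hs
  rw [norm_mul, norm_pow]
  have h1 : ‖(t : ℚ_[p])‖ ^ k ≤ 1 := pow_le_one₀ (norm_nonneg _) t.2
  calc _ ≤ ‖((PowerSeries.coeff k u : ℚ) : ℚ_[p])‖ * 1 := by gcongr
    _ ≤ _ := by
      rw [mul_one]
      refine (h k).trans (le_of_eq ?_)
      rw [← zpow_natCast, ← zpow_mul, ← zpow_add₀ hp0.ne']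
      congr 1
      ring

lemma good_mul (hl : 1 ≤ l) {w₁ w₂ : ℤ} {F₁ F₂ : ℤ_[p] → ℚ_[p]}
    (h₁ : GoodSeries p l w₁ F₁) (h₂ : GoodSeries p l w₂ F₂) :
    GoodSeries p l (w₁ + w₂) (fun t => F₁ t * F₂ t) := by
  obtain ⟨u, hu, hu'⟩ := h₁
  obtain ⟨v, hv, hv'⟩ := h₂
  have hp0 : (0 : ℝ) < p := p_pos_real
  refine ⟨u * v, fun k => ?_, fun t => ?_⟩
  · rw [PowerSeries.coeff_mul]
    push_cast
    apply IsUltrametricDist.norm_sum_le_of_forall_le_of_nonneg (by positivity)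
    intro ij hij
    rw [Finset.HasAntidiagonal.mem_antidiagonal] at hij
    rw [norm_mul]
    refine (mul_le_mul (hu _) (hv _) (norm_nonneg _) (by positivity)).trans (le_of_eq ?_)
    rw [← zpow_add₀ hp0.ne', ← hij]
    congr 1
    push_cast
    ring
  · have s1 := good_summable hl hu t
    have s2 := good_summable hl hv t
    have e := tsum_mul_tsum_eq_tsum_sum_antidiagonal_of_summable_norm s1 s2
    have s3 := (summable_norm_sum_mul_antidiagonal_of_summable_norm s1 s2).of_norm
    rw [(hu' t).tsum_eq, (hv' t).tsum_eq] at e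
    have s4 := s3.hasSum
    rw [← e] at s4
    refine hasSum_congr_fun s4 fun k => ?_
    rw [PowerSeries.coeff_mul]
    push_cast
    rw [Finset.sum_mul]
    refine Finset.sum_congr rfl fun ij hij => ?_
    rw [Finset.HasAntidiagonal.mem_antidiagonal] at hij
    rw [← hij, pow_add]
    ring

lemma good_mono {w w' : ℤ} {F : ℤ_[p] → ℚ_[p]} (hw : w' ≤ w)
    (h : GoodSeries p l w F) : GoodSeries p l w' F := by
  obtain ⟨u, hu, hu'⟩ := h
  refine ⟨u, fun k => (hu k).trans ?_, hu'⟩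
  apply zpow_le_zpow_right₀ p_one_lt_real.le
  omega

lemma good_const (c : ℚ) (w : ℤ) (hc : ‖(c : ℚ_[p])‖ ≤ (p : ℝ) ^ (-w)) :
    GoodSeries p l w (fun _ => (c : ℚ_[p])) := by
  have hp0 : (0 : ℝ) < p := p_pos_real
  refine ⟨PowerSeries.C c, fun k => ?_, fun t => ?_⟩
  · rw [PowerSeries.coeff_C]
    split_ifs with h
    · subst h; simpa using hc
    · simp only [Rat.cast_zero, norm_zero]; positivity
  · convert hasSum_single (α := ℚ_[p]) 0 ?_ using 1
    · simp
    · intro k hk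
      simp [PowerSeries.coeff_C, hk]

lemma good_linear (c : ℚ) (w : ℤ) (hc : ‖(c : ℚ_[p])‖ ≤ (p : ℝ) ^ (-w)) (hw : w + l ≤ 0) :
    GoodSeries p l w (fun t => (t : ℚ_[p]) + (c : ℚ_[p])) := by
  have hp0 : (0 : ℝ) < p := p_pos_real
  obtain ⟨u, hu, hu'⟩ := good_const (l := l) c w hc
  refine ⟨u + PowerSeries.X, fun k => ?_, fun t => ?_⟩
  · rw [map_add, PowerSeries.coeff_X]
    push_cast
    refine (IsUltrametricDist.norm_add_le_max _ _).trans (max_le (hu k) ?_)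
    split_ifs with h
    · subst h
      simp only [Rat.cast_one, norm_one, Nat.cast_one, mul_one]
      apply one_le_zpow₀ p_one_lt_real.le
      omega
    · simp only [Rat.cast_zero, norm_zero]; positivity
  · have h1 : HasSum (fun k : ℕ => ((PowerSeries.coeff k (PowerSeries.X : PowerSeries ℚ) : ℚ) : ℚ_[p])
        * (t : ℚ_[p]) ^ k) (t : ℚ_[p]) := by
      convert hasSum_single (α := ℚ_[p]) 1 ?_ using 1
      · simp [PowerSeries.coeff_X]
      · intro k hk
        simp [PowerSeries.coeff_X, hk]
    convert h1.add (hu' t) using 2 with k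
    rw [map_add]
    push_cast
    ring

lemma good_inv (hl : 1 ≤ l) (c : ℚ) (w : ℕ) (hc : ‖(c : ℚ_[p])‖ = (p : ℝ) ^ w) (hw : l ≤ w) :
    GoodSeries p l w (fun t => ((t : ℚ_[p]) + (c : ℚ_[p]))⁻¹) := by
  have hp0 : (0 : ℝ) < p := p_pos_real
  have hp1 : (1 : ℝ) < p := p_one_lt_real
  have hc0 : (c : ℚ_[p]) ≠ 0 := by
    rw [← norm_pos_iff, hc]; positivity
  refine ⟨PowerSeries.mk fun k => c⁻¹ * (-c⁻¹) ^ k, fun k => ?_, fun t => ?_⟩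
  · rw [PowerSeries.coeff_mk]
    push_cast
    rw [norm_mul, norm_pow, norm_neg, norm_inv, hc, ← zpow_natCast, ← zpow_neg, ← zpow_natCast,
      ← zpow_mul, ← zpow_add₀ hp0.ne']
    apply zpow_le_zpow_right₀ hp1.le
    have : (l : ℤ) * k ≤ w * k := by gcongr
    linarith
  · have hlt : ‖-(t : ℚ_[p]) * (c : ℚ_[p])⁻¹‖ < 1 := by
      rw [norm_mul, norm_neg, norm_inv, hc]
      have h1 : ‖(t : ℚ_[p])‖ ≤ 1 := t.2
      have h2 : ((p : ℝ) ^ w)⁻¹ < 1 := inv_lt_one_of_one_lt₀ (one_lt_pow₀ hp1 (by omega))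
      have h3 : 0 < ((p : ℝ) ^ w)⁻¹ := by positivity
      nlinarith
    have h := (hasSum_geometric_of_norm_lt_one hlt).mul_left (c : ℚ_[p])⁻¹
    have e2 : ((t : ℚ_[p]) + (c : ℚ_[p]))⁻¹ =
        (c : ℚ_[p])⁻¹ * (1 - -(t : ℚ_[p]) * (c : ℚ_[p])⁻¹)⁻¹ := by
      rw [← mul_inv]
      congr 1
      field_simp
      ring
    rw [← e2] at h
    refine hasSum_congr_fun h fun k => ?_
    rw [PowerSeries.coeff_mk]
    push_cast
    rw [mul_assoc, ← mul_pow]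
    congr 2
    ring

lemma good_prod {ι : Type*} (hl : 1 ≤ l) (S : Finset ι) (w : ι → ℤ) (F : ι → ℤ_[p] → ℚ_[p])
    (h : ∀ i ∈ S, GoodSeries p l (w i) (F i)) :
    GoodSeries p l (∑ i ∈ S, w i) (fun t => ∏ i ∈ S, F i t) := by
  classical
  induction S using Finset.induction_on with
  | empty => simpa using good_const (p := p) (l := l) 1 0 (by simp)
  | insert a S ha ih =>
    simp only [Finset.sum_insert ha, Finset.prod_insert ha]
    exact good_mul hl (h a (Finset.mem_insert_self _ _))
      (ih fun i hi => h i (Finset.mem_insert_of_mem hi))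

lemma good_pow (hl : 1 ≤ l) {w : ℤ} {F : ℤ_[p] → ℚ_[p]} (h : GoodSeries p l w F) (s : ℕ) :
    GoodSeries p l (s * w) (fun t => F t ^ s) := by
  have := good_prod hl (Finset.range s) (fun _ => w) (fun _ => F) (fun _ _ => h)
  simpa using this

lemma norm_nat_le_of_dvd {e N : ℕ} (h : p ^ e ∣ N) : ‖(N : ℚ_[p])‖ ≤ (p : ℝ) ^ (-(e : ℤ)) := by
  obtain ⟨c, rfl⟩ := h
  push_cast
  rw [norm_mul, norm_pow, Padic.norm_p, zpow_neg, zpow_natCast, inv_pow]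
  have h1 : ‖(c : ℚ_[p])‖ ≤ 1 := by simpa using Padic.norm_int_le_one (p := p) (c : ℤ)
  have hp0 : (0 : ℝ) < p := p_pos_real
  exact mul_le_of_le_one_right (by positivity) h1

end good

lemma pow_le_succ_pow {p d : ℕ} (hd : d + 1 ≤ p) : p ^ d ≤ (d + 1) ^ (p - 1) := by
  rcases Nat.eq_zero_or_pos d with rfl | h0
  · simp
  have hd0 : (0 : ℝ) < d := by exact_mod_cast h0
  have hdp : (d : ℝ) + 1 ≤ p := by exact_mod_cast hd
  have h := one_add_mul_self_le_rpow_one_add (s := (d : ℝ)) (by linarith) (p := ((p : ℝ) - 1) / d)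
    (by rw [le_div_iff₀ hd0]; linarith)
  rw [div_mul_cancel₀ _ hd0.ne', add_sub_cancel] at h
  have h2 : (p : ℝ) ^ d ≤ ((1 + (d : ℝ)) ^ (((p : ℝ) - 1) / d)) ^ d := by gcongr
  rw [← Real.rpow_natCast (_ ^ _), ← Real.rpow_mul (by positivity), div_mul_cancel₀ _ hd0.ne',
    show (p : ℝ) - 1 = ((p - 1 : ℕ) : ℝ) by rw [Nat.cast_sub (by omega)]; simp, Real.rpow_natCast] at h2
  rw [add_comm d 1]
  exact_mod_cast h2

lemma pow_digits_sum_le {p : ℕ} (hp : 1 < p) (n : ℕ) :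
    p ^ (p.digits n).sum ≤ (n + 1) ^ (p - 1) := by
  induction n using Nat.strong_induction_on with
  | _ n ih =>
    rcases Nat.eq_zero_or_pos n with rfl | h0
    · simp
    rw [Nat.digits_def' hp h0, List.sum_cons, pow_add]
    have hm : n % p + 1 ≤ p := Nat.mod_lt _ (by omega)
    have h1 := ih (n / p) (Nat.div_lt_self h0 hp)
    refine (Nat.mul_le_mul (pow_le_succ_pow hm) h1).trans ?_
    rw [← mul_pow]
    apply Nat.pow_le_pow_left
    have h2 := Nat.div_add_mod n p
    have h3 : (n / p) * (n % p + 1) ≤ (n / p) * p := Nat.mul_le_mul_left _ hm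
    nlinarith

lemma factorial_val_ge {p : ℕ} [hp : Fact p.Prime] (n : ℕ) :
    (n : ℝ) / ((p : ℝ) - 1) - Real.log ((n : ℝ) + 1) / Real.log p
      ≤ (padicValNat p n.factorial : ℝ) := by
  have hp1 : (1 : ℝ) < p := p_one_lt_real
  have h := sub_one_mul_padicValNat_factorial (p := p) n
  have h2 := pow_digits_sum_le hp.out.one_lt n
  have h3 : ((p : ℝ) - 1) * (padicValNat p n.factorial : ℝ) = n - ((p.digits n).sum : ℝ) := by
    have := Nat.digit_sum_le p n
    have h' := congrArg (Nat.cast : ℕ → ℝ) h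
    rw [Nat.cast_mul, Nat.cast_sub hp.out.one_le, Nat.cast_sub this, Nat.cast_one] at h'
    exact h'
  have h4 : ((p.digits n).sum : ℝ) * Real.log p ≤ ((p : ℝ) - 1) * Real.log ((n : ℝ) + 1) := by
    have h5 : ((p : ℝ) ^ (p.digits n).sum) ≤ ((n : ℝ) + 1) ^ (p - 1) := by exact_mod_cast h2
    have h6 := Real.log_le_log (by positivity) h5
    rw [Real.log_pow, Real.log_pow, Nat.cast_sub hp.out.one_le] at h6
    simpa using h6
  have hlog : 0 < Real.log p := Real.log_pos hp1
  have hq : 0 < (p : ℝ) - 1 := by linarith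
  rw [sub_le_iff_le_add, div_le_iff₀ hq, add_mul, mul_comm (padicValNat _ _ : ℝ), h3]
  have : ((p.digits n).sum : ℝ) ≤ Real.log ((n : ℝ) + 1) / Real.log p * ((p : ℝ) - 1) := by
    rw [div_mul_eq_mul_div, le_div_iff₀ hlog]; linarith
  linarith

lemma Z_facts {p : ℕ} [hp : Fact p.Prime] {l : ℕ} (hl : 1 ≤ l) {a b : ℕ} (hb : 1 ≤ b)
    (hg : Nat.gcd a (p ^ l * b) = 1) {x : ℚ} (hx : x = (a : ℚ) / ((p ^ l * b : ℕ) : ℚ)) :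
    x.den = p ^ l * b ∧ x.num = a ∧ ‖(x : ℚ_[p])‖ = (p : ℝ) ^ (padicValNat p x.den) ∧
      l ≤ padicValNat p x.den := by
  have hN : 0 < p ^ l * b := Nat.mul_pos (pow_pos hp.out.pos _) hb
  have hxd : x.den = p ^ l * b := by
    have := Rat.den_div_eq_of_coprime (a := (a : ℤ)) (b := ((p ^ l * b : ℕ) : ℤ))
      (by exact_mod_cast hN) (by simpa only [Int.natAbs_natCast] using hg)
    rw [Int.cast_natCast, Int.cast_natCast, ← hx] at this
    exact Nat.cast_injective this
  have hxn : x.num = a := by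
    have := Rat.num_div_eq_of_coprime (a := (a : ℤ)) (b := ((p ^ l * b : ℕ) : ℤ))
      (by exact_mod_cast hN) (by simpa only [Int.natAbs_natCast] using hg)
    rw [Int.cast_natCast, Int.cast_natCast, ← hx] at this
    exact this
  refine ⟨hxd, hxn, ?_, ?_⟩
  · have hcop : p.Coprime a := by
      have h1 : p ∣ p ^ l * b := Dvd.dvd.mul_right (dvd_pow_self p (by omega)) b
      exact (Nat.Coprime.coprime_dvd_right h1 hg).symm
    have h1 : ‖(a : ℚ_[p])‖ = 1 := Padic.norm_natCast_eq_one_iff.mpr hcop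
    have h2 : ‖((p ^ l * b : ℕ) : ℚ_[p])‖ = (p : ℝ) ^ (-(padicValNat p (p ^ l * b) : ℤ)) := by
      rw [Padic.norm_eq_zpow_neg_valuation (by exact_mod_cast hN.ne'), Padic.valuation_natCast]
    have h3 : (x : ℚ_[p]) = (a : ℚ_[p]) / ((p ^ l * b : ℕ) : ℚ_[p]) := by
      rw [hx, Rat.cast_div, Rat.cast_natCast, Rat.cast_natCast]
    rw [h3, norm_div, h1, h2, hxd, zpow_neg, zpow_natCast, one_div, inv_inv]
  · rw [hxd, ← padicValNat_dvd_iff_le hN.ne']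
    exact Dvd.intro _ rfl

lemma Z_sum_le {N : ℕ} (hN : 0 < N) (Ψ : Finset ℕ) (Z : Finset ℚ)
    (h : ∀ x ∈ Z, (∃ b ∈ Ψ, x.den = N * b) ∧ 1 ≤ x.num ∧ x.num ≤ x.den) (f : ℕ → ℕ) :
    ∑ x ∈ Z, f x.den ≤ ∑ b ∈ Ψ, (N * b).totient * f (N * b) := by
  have hm : ∀ x ∈ Z, x.den / N ∈ Ψ := by
    intro x hx
    obtain ⟨⟨b, hb, e⟩, -⟩ := h x hx
    rw [e, Nat.mul_div_cancel_left _ hN]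
    exact hb
  rw [← Finset.sum_fiberwise_of_maps_to hm]
  refine Finset.sum_le_sum fun b hb => ?_
  have key : ∀ x ∈ Z.filter (fun x => x.den / N = b), x.den = N * b := by
    intro x hx
    rw [Finset.mem_filter] at hx
    obtain ⟨⟨b', -, e⟩, -⟩ := h x hx.1
    rw [e, Nat.mul_div_cancel_left _ hN] at hx
    rw [e, hx.2]
  rw [Finset.sum_congr rfl (fun x hx => by rw [key x hx]), Finset.sum_const, smul_eq_mul]
  apply Nat.mul_le_mul_right
  have hmaps : ∀ x ∈ Z.filter (fun x => x.den / N = b),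
      x.num.toNat ∈ (Finset.Ioc 0 (N * b)).filter (fun a => (N * b).Coprime a) := by
    intro x hx
    have e := key x hx
    have hxZ := (Finset.mem_filter.mp hx).1
    obtain ⟨-, h1, h2⟩ := h x hxZ
    have hred := x.reduced
    rw [Finset.mem_filter, Finset.mem_Ioc, ← e]
    refine ⟨⟨by omega, by omega⟩, ?_⟩
    have : x.num.toNat = x.num.natAbs := by omega
    rw [this]
    exact hred.symm
  have hinj : Set.InjOn (fun x : ℚ => x.num.toNat)
      (Z.filter (fun x => x.den / N = b) : Finset ℚ) := by
    intro x hx y hy hxy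
    rw [Finset.mem_coe] at hx hy
    have h1 := (h x (Finset.mem_filter.mp hx).1).2
    have h2 := (h y (Finset.mem_filter.mp hy).1).2
    refine Rat.ext ?_ ?_
    · simp only at hxy
      omega
    · rw [key x hx, key y hy]
  refine (Finset.card_le_card_of_injOn _ hmaps hinj).trans (le_of_eq ?_)
  rw [Nat.totient_eq_card_coprime]
  rcases Nat.eq_zero_or_pos (N * b) with h0 | h0
  · simp [h0]
  rcases Nat.lt_or_ge 1 (N * b) with h1 | h1
  · congr 1
    ext a
    simp only [Finset.mem_filter, Finset.mem_Ioc, Finset.mem_range]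
    constructor
    · rintro ⟨⟨h2, h3⟩, h4⟩
      refine ⟨lt_of_le_of_ne h3 ?_, h4⟩
      rintro rfl
      rw [Nat.coprime_self] at h4
      omega
    · rintro ⟨h2, h3⟩
      refine ⟨⟨Nat.pos_of_ne_zero ?_, h2.le⟩, h3⟩
      rintro rfl
      rw [Nat.coprime_zero_right] at h3
      omega
  · have : N * b = 1 := by omega
    rw [this]
    rfl
lemma good_nat {p : ℕ} [Fact p.Prime] {l : ℕ} {e N : ℕ} (h : p ^ e ∣ N) :
    GoodSeries p l e (fun _ => (N : ℚ_[p])) := by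
  have := good_const (p := p) (l := l) (N : ℚ) e (by
    rw [Rat.cast_natCast]; exact norm_nat_le_of_dvd h)
  simpa only [Rat.cast_natCast] using this

/-- Lemma 6.1: for `θ ∈ 𝒵_B`, the function `t ↦ R_n(t+θ)` on
`ℤ_p` is given by an overconvergent power series `∑ u_k t^k` with `u_k ∈ ℚ` and
`v_p(u_k) ≥ (l_p + 1/(p-1))sn - (log(n+1)/log p)(s-|𝒵_B|) + l_p(s+k)`. -/
theorem Rn_shift_overconvergent_valuation_bound
    (p : ℕ) [Fact p.Prime] (B : ℝ) (Ψ : Finset ℕ)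
    (hΨ : ∀ b : ℕ, b ∈ Ψ ↔ 1 ≤ b ∧ ((p ^ ellp p * b).totient : ℝ) ≤ B)
    (bmax : ℕ) (hbmem : bmax ∈ Ψ) (hbmax : ∀ b ∈ Ψ, b ≤ bmax)
    (Z : Finset ℚ)
    (hZ : ∀ x : ℚ, x ∈ Z ↔ ∃ a b : ℕ, b ∈ Ψ ∧ 1 ≤ a ∧ a ≤ p ^ ellp p * b ∧
      Nat.gcd a (p ^ ellp p * b) = 1 ∧ x = (a : ℚ) / ((p ^ ellp p * b : ℕ) : ℚ))
    (s : ℕ) (hsodd : Odd s) (hscard : Z.card + 1 < s)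
    (n : ℕ) (hnprime : (n + 1).Prime)
    (hndvd : ((Ψ.biUnion fun b => (p ^ ellp p * b).primeFactors).lcm (fun q => q - 1)) *
      p ^ ellp p * bmax ∣ n)
    (hdeg : (2 : ℤ) ≤ ((n : ℤ) + 1) * s - n * ((Z.card : ℤ) - 1) -
      (((p ^ ellp p * bmax - 1) * n / (p ^ ellp p * bmax) : ℕ) : ℤ) + 1)
    (θ : ℚ) (hθ : θ ∈ Z) :
    ∃ u : ℕ → ℚ,
      (∀ t : ℤ_[p], HasSum (fun k : ℕ => ((u k : ℚ) : ℚ_[p]) * ((t : ℚ_[p])) ^ k)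
        (RfunP p Ψ Z bmax s n ((t : ℚ_[p]) + ((θ : ℚ) : ℚ_[p])))) ∧
      (∃ C : ℝ, ∀ k : ℕ, ‖((u k : ℚ) : ℚ_[p])‖ * (p : ℝ) ^ (ellp p * k) ≤ C) ∧
      (∀ k : ℕ, u k ≠ 0 →
        ((ellp p : ℝ) + 1 / ((p : ℝ) - 1)) * s * n -
            (Real.log ((n : ℝ) + 1) / Real.log p) * ((s : ℝ) - Z.card) +
            (ellp p : ℝ) * ((s : ℝ) + k) ≤ (padicValRat p (u k) : ℝ)) := by
  have hp : p.Prime := Fact.out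
  have hl : 1 ≤ ellp p := by unfold ellp; split_ifs <;> omega
  have hp1 : (1 : ℝ) < p := p_one_lt_real
  have hp0 : (0 : ℝ) < p := p_pos_real
  have hq : 0 < (p : ℝ) - 1 := by linarith
  have hpl : 0 < p ^ ellp p := pow_pos hp.pos _
  set l := ellp p with hldef
  have hb1 : 1 ≤ bmax := ((hΨ bmax).mp hbmem).1
  have hNb2 : 2 ≤ p ^ l * bmax := by
    have h1 : p ^ 1 ≤ p ^ l := Nat.pow_le_pow_right hp.pos hl
    have h2 := hp.two_le
    nlinarith
  -- facts about the elements of `Z`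
  have hZf : ∀ x ∈ Z, ((∃ b ∈ Ψ, x.den = p ^ l * b) ∧ 1 ≤ x.num ∧ x.num ≤ x.den) ∧
      ‖(x : ℚ_[p])‖ = (p : ℝ) ^ (padicValNat p x.den) ∧ l ≤ padicValNat p x.den := by
    intro x hx
    obtain ⟨a, b, hb, ha1, ha2, hg, he⟩ := (hZ x).mp hx
    obtain ⟨h1, h2, h3, h4⟩ := Z_facts (p := p) hl ((hΨ b).mp hb).1 hg he
    refine ⟨⟨⟨b, hb, h1⟩, ?_, ?_⟩, h3, h4⟩
    · rw [h2]; exact_mod_cast ha1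
    · rw [h2, h1]; exact_mod_cast ha2
  have hmaxZ : (((p ^ l * bmax : ℕ) : ℚ) - 1) / ((p ^ l * bmax : ℕ) : ℚ) ∈ Z := by
    rw [hZ]
    refine ⟨p ^ l * bmax - 1, bmax, hbmem, by omega, by omega, ?_, ?_⟩
    · obtain ⟨c, hc⟩ : ∃ c, p ^ l * bmax = c + 1 := ⟨p ^ l * bmax - 1, by omega⟩
      rw [hc, Nat.add_sub_cancel]
      exact Nat.coprime_self_add_right.mpr (Nat.coprime_one_right c)
    · rw [Nat.cast_sub (by omega), Nat.cast_one]
  obtain ⟨-, hθn, hθl⟩ := hZf θ hθ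
  obtain ⟨β, hβ⟩ := Nat.exists_eq_add_of_le hθl
  rw [hβ] at hθn
  -- divisibility of the normalizing constants
  set vd : ℚ → ℕ := fun x => padicValNat p x.den with hvd
  have hA1 : p ^ (∑ x ∈ Z, vd x) ∣ ∏ b ∈ Ψ, (p ^ l * b) ^ (p ^ l * b).totient := by
    refine (pow_dvd_pow p (Z_sum_le hpl Ψ Z (fun x hx => (hZf x hx).1) (padicValNat p))).trans ?_
    rw [← Finset.prod_pow_eq_pow_sum]
    refine Finset.prod_dvd_prod_of_dvd _ _ fun b _ => ?_
    rw [mul_comm (Nat.totient _), pow_mul]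
    exact pow_dvd_pow_of_dvd pow_padicValNat_dvd _
  obtain ⟨f, hf, hA2⟩ : ∃ f : ℕ, Z.card ≤ (p - 1) * f ∧ p ^ f ∣
      ∏ b ∈ Ψ, ∏ q ∈ (p ^ l * b).primeFactors, q ^ ((p ^ l * b).totient / (q - 1)) := by
    refine ⟨∑ b ∈ Ψ, (p ^ l * b).totient / (p - 1), ?_, ?_⟩
    · have h := Z_sum_le hpl Ψ Z (fun x hx => (hZf x hx).1) (fun _ => 1)
      simp only [mul_one, Finset.sum_const, smul_eq_mul] at h
      refine h.trans (le_of_eq ?_)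
      rw [Finset.mul_sum]
      refine Finset.sum_congr rfl fun b _ => ?_
      have hdv : p ∣ p ^ l * b := Dvd.dvd.mul_right (dvd_pow_self p (by omega)) b
      have := Nat.totient_dvd_of_dvd hdv
      rw [Nat.totient_prime hp] at this
      rw [Nat.mul_div_cancel' this]
    · rw [← Finset.prod_pow_eq_pow_sum]
      refine Finset.prod_dvd_prod_of_dvd _ _ fun b hb => ?_
      have hb1 := ((hΨ b).mp hb).1
      have hmem : p ∈ (p ^ l * b).primeFactors := by
        rw [Nat.mem_primeFactors]
        exact ⟨hp, Dvd.dvd.mul_right (dvd_pow_self p (by omega)) b, (Nat.mul_pos hpl hb1).ne'⟩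
      exact Finset.dvd_prod_of_mem (fun q => q ^ ((p ^ l * b).totient / (q - 1))) hmem
  obtain ⟨m1, hm1⟩ : ∃ m1, m1 = (p ^ l * bmax - 1) * n / (p ^ l * bmax) - 1 := ⟨_, rfl⟩
  have hm1n : m1 ≤ n := by
    have : (p ^ l * bmax - 1) * n / (p ^ l * bmax) ≤ n :=
      Nat.div_le_of_le_mul (Nat.mul_le_mul_right _ (by omega))
    omega
  obtain ⟨θm, hθm⟩ : ∃ θm : ℚ, θm = (((p ^ l * bmax : ℕ) : ℚ) - 1) / ((p ^ l * bmax : ℕ) : ℚ) :=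
    ⟨_, rfl⟩
  rw [← hθm] at hmaxZ
  set v := padicValNat p n.factorial with hv
  -- numerators
  have hnat : ∀ j : ℕ, ‖(j : ℚ_[p])‖ ≤ 1 := fun j => by
    simpa using Padic.norm_int_le_one (p := p) (j : ℤ)
  have hnum : ∀ x ∈ Z, ∀ j : ℕ, GoodSeries p l (-((vd x : ℤ) + β))
      (fun t => (t : ℚ_[p]) + (θ : ℚ_[p]) + (x : ℚ_[p]) + (j : ℚ_[p])) := by
    intro x hx j
    obtain ⟨-, hxn, hxl⟩ := hZf x hx
    have hxl' : l ≤ vd x := hxl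
    have h := good_linear (p := p) (l := l) (θ + x + j) (-((vd x : ℤ) + β)) (by
      push_cast
      have hb : ∀ e : ℕ, e ≤ vd x + β → (p : ℝ) ^ e ≤ (p : ℝ) ^ (- -((vd x : ℤ) + β)) := by
        intro e he
        rw [neg_neg, show ((vd x : ℤ) + β) = ((vd x + β : ℕ) : ℤ) by push_cast; ring, zpow_natCast]
        exact pow_le_pow_right₀ hp1.le he
      refine (IsUltrametricDist.norm_add_le_max _ _).trans (max_le
        ((IsUltrametricDist.norm_add_le_max _ _).trans (max_le ?_ ?_)) ?_)
      · rw [hθn]; exact hb _ (by omega)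
      · rw [hxn]; exact hb _ (Nat.le_add_right _ _)
      · refine (hnat j).trans ?_
        simpa using hb 0 (by omega)) (by omega)
    have e : (fun t : ℤ_[p] => (t : ℚ_[p]) + (θ : ℚ_[p]) + (x : ℚ_[p]) + (j : ℚ_[p])) =
        fun t : ℤ_[p] => (t : ℚ_[p]) + ((θ + x + j : ℚ) : ℚ_[p]) := by
      funext t
      push_cast
      ring
    rw [e]
    exact h
  have hden : ∀ j : ℕ, GoodSeries p l ((l + β : ℕ) : ℤ)
      (fun t => ((t : ℚ_[p]) + (θ : ℚ_[p]) + (j : ℚ_[p]))⁻¹) := by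
    intro j
    have h := good_inv (p := p) hl (θ + j) (l + β) (by
      push_cast
      have hlt : ‖(j : ℚ_[p])‖ < ‖(θ : ℚ_[p])‖ := by
        rw [hθn]
        exact (hnat j).trans_lt (one_lt_pow₀ hp1 (by omega))
      rw [IsUltrametricDist.norm_add_eq_max_of_norm_ne_norm hlt.ne', max_eq_left hlt.le, hθn])
      (by omega)
    have e : (fun t : ℤ_[p] => ((t : ℚ_[p]) + (θ : ℚ_[p]) + (j : ℚ_[p]))⁻¹) =
        fun t : ℤ_[p] => ((t : ℚ_[p]) + ((θ + j : ℚ) : ℚ_[p]))⁻¹ := by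
      funext t
      push_cast
      ring
    rw [e]
    exact h
  obtain ⟨q, hqf⟩ : m1.factorial ∣ n.factorial := Nat.factorial_dvd_factorial hm1n
  -- assembling
  have hG : GoodSeries p l ((f : ℤ) * n + v * ((s : ℤ) - Z.card) + s * (n + 1) * l)
      (fun t => RfunP p Ψ Z bmax s n ((t : ℚ_[p]) + (θ : ℚ_[p]))) := by
    have g1 := good_pow hl (good_nat (l := l) hA1) n
    have g2 := good_pow hl (good_nat (l := l) hA2) n
    have g3 := good_pow hl (good_nat (p := p) (l := l) (N := n.factorial) (e := v)
      pow_padicValNat_dvd) (s - Z.card)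
    have g4 := good_nat (p := p) (l := l) (e := 0) (N := q) (by simp)
    have g5 := good_prod hl (Finset.range m1) _ _ (fun j _ => hnum θm hmaxZ j)
    have g6 := good_prod hl (Z.erase θm) _ _ (fun x hx =>
      good_prod hl (Finset.range n) _ _ (fun j _ => hnum x (Finset.mem_of_mem_erase hx) j))
    have g7 := good_pow hl (good_prod hl (Finset.range (n + 1)) _ _ (fun j _ => hden j)) s
    have g := good_mul hl (good_mul hl (good_mul hl (good_mul hl (good_mul hl g1 g2)
      (good_mul hl g3 g4)) g5) g6) g7
    refine good_mono ?_ ((congrArg _ (funext fun t => ?_)).mp g)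
    · simp only [Finset.sum_const, Finset.card_range, nsmul_eq_mul, Nat.cast_sum]
      have hE := Finset.sum_erase_add Z (fun x => (n : ℤ) * (-((vd x : ℤ) + β))) hmaxZ
      have hE2 : ∑ x ∈ Z, (n : ℤ) * (-((vd x : ℤ) + β)) =
          -(n * ∑ x ∈ Z, (vd x : ℤ)) - n * Z.card * β := by
        rw [← Finset.mul_sum, Finset.sum_neg_distrib, Finset.sum_add_distrib, Finset.sum_const]
        simp only [nsmul_eq_mul]
        ring
      rw [hE2] at hE
      have h8 : (m1 : ℤ) * ((vd θm : ℤ) + β) ≤ n * ((vd θm : ℤ) + β) := by gcongr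
      have h9 : (n : ℤ) * Z.card * β ≤ (n + 1) * s * β := by
        have : (Z.card : ℤ) ≤ s := by omega
        gcongr
        omega
      have h10 : ((s - Z.card : ℕ) : ℤ) = (s : ℤ) - Z.card := by omega
      rw [h10]
      push_cast
      linarith
    · simp only [RfunP]
      rw [← hldef, ← hm1, ← hθm]
      have hm0 : (m1.factorial : ℚ_[p]) ≠ 0 := by exact_mod_cast m1.factorial_ne_zero
      have h3 : (n.factorial : ℚ_[p]) ^ (s - Z.card + 1) / (m1.factorial : ℚ_[p]) =
          (n.factorial : ℚ_[p]) ^ (s - Z.card) * (q : ℚ_[p]) := by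
        rw [pow_succ, div_eq_iff hm0, mul_assoc]
        congr 1
        rw [hqf]
        push_cast
        ring
      rw [h3, Finset.prod_inv_distrib, inv_pow, ← div_eq_mul_inv]
  obtain ⟨u, hu, hu'⟩ := hG
  refine ⟨fun k => PowerSeries.coeff k u, hu', ?_, ?_⟩
  · refine ⟨(p : ℝ) ^ (-((f : ℤ) * n + v * ((s : ℤ) - Z.card) + s * (n + 1) * l)), fun k => ?_⟩
    refine (mul_le_mul_of_nonneg_right (hu k) (by positivity)).trans (le_of_eq ?_)
    rw [← zpow_natCast, ← zpow_add₀ hp0.ne']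
    congr 1
    push_cast
    ring
  · intro k hk
    have h1 := hu k
    rw [Padic.norm_eq_zpow_neg_valuation (by exact_mod_cast hk), Padic.valuation_ratCast,
      zpow_le_zpow_iff_right₀ hp1, neg_le_neg_iff] at h1
    have h2 : ((f : ℝ) * n + v * ((s : ℝ) - Z.card) + s * (n + 1) * l + l * k) ≤
        (padicValRat p (PowerSeries.coeff k u) : ℝ) := by exact_mod_cast h1
    refine le_trans ?_ h2
    have h3 := factorial_val_ge (p := p) n
    have h4 : (Z.card : ℝ) / ((p : ℝ) - 1) ≤ f := by
      rw [div_le_iff₀ hq, mul_comm]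
      have : (Z.card : ℝ) ≤ ((p - 1 : ℕ) : ℝ) * f := by exact_mod_cast hf
      rwa [Nat.cast_sub hp.one_le, Nat.cast_one] at this
    have h5 : (0 : ℝ) ≤ (s : ℝ) - Z.card := by
      have : (Z.card : ℝ) ≤ s := by exact_mod_cast (by omega : Z.card ≤ s)
      linarith
    have h6 := mul_le_mul_of_nonneg_right h3 h5
    have h7 := mul_le_mul_of_nonneg_right h4 (Nat.cast_nonneg (α := ℝ) n)
    have e : ((l : ℝ) + 1 / ((p : ℝ) - 1)) * s * n -
            (Real.log ((n : ℝ) + 1) / Real.log p) * ((s : ℝ) - Z.card) + (l : ℝ) * ((s : ℝ) + k) =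
        (Z.card : ℝ) / ((p : ℝ) - 1) * n + ((n : ℝ) / ((p : ℝ) - 1) -
          Real.log ((n : ℝ) + 1) / Real.log p) * ((s : ℝ) - Z.card) + s * (n + 1) * l + l * k := by
      ring
    rw [e]
    linarith
end

section
/- With the standing setup (prime p, l_p, B, Ψ_B, 𝒵_B, b_max, θ_max, θ_min, A_1(B), A_2(B), P_B, I, odd s, n ∈ I, and the rational function R_n), set k_0 = n·|𝒵_B| − θ_min·n − 1. Then there is a sequence of integers (h_k)_{k ≥ (n+1)s − k_0} such that for every t ∈ ℚ_p with |t|_p > 1, the series Σ_{k ≥ (n+1)s − k_0} h_k · t^{−k} converges in ℚ_p to R_n(t), and for every integer k ≥ (n+1)s − k_0 one has v_p(h_k) ≥ s·n/(p−1) − (log(n+1)/log p)·(s − |𝒵_B|) + l_p · max{0, (n+1)s − k}. -/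
theorem aux_val (p : ℕ) (hp : p.Prime) (n : ℕ) :
    ((p.digits n).sum : ℝ) / ((p:ℝ) - 1) ≤ Real.log ((n:ℝ)+1) / Real.log p := by
  have hp2 : (2:ℝ) ≤ p := by exact_mod_cast hp.two_le
  have hlog : 0 < Real.log p := Real.log_pos (by linarith)
  rw [div_le_div_iff₀ (by linarith) hlog]
  induction n using Nat.strong_induction_on with
  | _ n ih =>
    rcases Nat.eq_zero_or_pos n with h0 | hpos
    · subst h0; simp
    · rw [Nat.digits_def' hp.one_lt hpos, List.sum_cons]
      have ih' := ih (n / p) (Nat.div_lt_self hpos hp.one_lt)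
      set r := n % p with hr
      set m := n / p with hm
      have hn : p * m + r = n := Nat.div_add_mod n p
      have hrp : r + 1 ≤ p := Nat.mod_lt _ hp.pos
      have hrp' : (r:ℝ) + 1 ≤ p := by exact_mod_cast hrp
      have hr0 : (0:ℝ) ≤ r := by positivity
      have hm0 : (0:ℝ) ≤ m := by positivity
      have hn' : (n:ℝ) = p * m + r := by exact_mod_cast hn.symm
      have key : (r:ℝ) * Real.log p ≤ Real.log (1 + r) * ((p:ℝ)-1) := by
        have h1 := rpow_one_add_le_one_add_mul_self (s := (p:ℝ)-1) (by linarith)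
          (p := (r:ℝ)/((p:ℝ)-1)) (by apply div_nonneg hr0; linarith)
          (by rw [div_le_one (by linarith)]; linarith)
        have h2 : (r:ℝ)/((p:ℝ)-1) * ((p:ℝ)-1) = r := div_mul_cancel₀ _ (by linarith)
        rw [h2] at h1
        have h3 := Real.log_le_log (by apply Real.rpow_pos_of_pos; linarith) h1
        rw [Real.log_rpow (by linarith)] at h3
        have h4 : (1 + ((p:ℝ)-1)) = p := by ring
        rw [h4] at h3
        have := mul_le_mul_of_nonneg_right h3 (show (0:ℝ) ≤ (p:ℝ)-1 by linarith)
        calc (r:ℝ) * Real.log p = (r:ℝ)/((p:ℝ)-1) * ((p:ℝ)-1) * Real.log p := by rw [h2]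
          _ = _ := by ring
          _ ≤ _ := this
      have h5 : Real.log (1+r) + Real.log (m+1) ≤ Real.log (n+1) := by
        rw [← Real.log_mul (by positivity) (by positivity)]
        apply Real.log_le_log (by positivity)
        rw [hn']; nlinarith
      rw [Nat.cast_add]
      nlinarith [mul_le_mul_of_nonneg_right h5 (show (0:ℝ) ≤ (p:ℝ)-1 by linarith)]

theorem aux_fact (p : ℕ) [hp : Fact p.Prime] (n : ℕ) :
    (n:ℝ) / ((p:ℝ)-1) - Real.log ((n:ℝ)+1) / Real.log p ≤ padicValNat p n.factorial := by
  have h := aux_val p hp.out n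
  have h2 := sub_one_mul_padicValNat_factorial (p := p) n
  have hp2 : (2:ℝ) ≤ p := by exact_mod_cast hp.out.two_le
  have h3 : ((p:ℝ)-1) * padicValNat p n.factorial = n - (p.digits n).sum := by
    rw [← Nat.cast_sub (Nat.digit_sum_le p n), ← h2]
    push_cast [Nat.cast_sub hp.out.one_le]; ring
  have h4 : (padicValNat p n.factorial : ℝ) = n / ((p:ℝ)-1) - (p.digits n).sum/((p:ℝ)-1) := by
    rw [← sub_div, ← h3]; field_simp [show (p:ℝ)-1 ≠ 0 by linarith]
  linarith

section
variable {p : ℕ} [Fact p.Prime]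
open Polynomial

theorem ev_summable {u : ℚ_[p]} (hu : ‖u‖ < 1) (F : PowerSeries ℤ) :
    Summable (fun k => ‖((PowerSeries.coeff k F : ℤ) : ℚ_[p]) * u ^ k‖) := by
  refine Summable.of_nonneg_of_le (fun _ => norm_nonneg _) (fun k => ?_)
    (summable_geometric_of_lt_one (norm_nonneg u) hu)
  rw [norm_mul, norm_pow]
  exact mul_le_of_le_one_left (by positivity) (Padic.norm_int_le_one _)

theorem ev_mul {u : ℚ_[p]} (hu : ‖u‖ < 1) (F G : PowerSeries ℤ) :
    (∑' k, ((PowerSeries.coeff k F : ℤ) : ℚ_[p]) * u ^ k) *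
    (∑' k, ((PowerSeries.coeff k G : ℤ) : ℚ_[p]) * u ^ k) =
    ∑' k, ((PowerSeries.coeff k (F * G) : ℤ) : ℚ_[p]) * u ^ k := by
  rw [tsum_mul_tsum_eq_tsum_sum_antidiagonal_of_summable_norm (ev_summable hu F) (ev_summable hu G)]
  congr 1; ext k
  rw [PowerSeries.coeff_mul]
  push_cast
  rw [Finset.sum_mul]
  apply Finset.sum_congr rfl
  intro x hx
  rw [← Finset.HasAntidiagonal.mem_antidiagonal.mp hx, pow_add]; ring

theorem ev_poly (u : ℚ_[p]) (f : ℤ[X]) :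
    (∑' k, ((PowerSeries.coeff k (f : PowerSeries ℤ) : ℤ) : ℚ_[p]) * u ^ k) =
      eval₂ (Int.castRingHom ℚ_[p]) u f := by
  rw [eval₂_eq_sum_range, tsum_eq_sum (s := Finset.range (f.natDegree + 1))]
  · simp
  · intro k hk
    have : f.coeff k = 0 := coeff_eq_zero_of_natDegree_lt (by simpa using hk)
    simp [this]

theorem ev_main {u : ℚ_[p]} (hu : ‖u‖ < 1) (Q P : ℤ[X]) (hP : P.coeff 0 = 1) :
    HasSum (fun k => ((PowerSeries.coeff k ((Q : PowerSeries ℤ) *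
      PowerSeries.invOfUnit (P : PowerSeries ℤ) 1) : ℤ) : ℚ_[p]) * u ^ k)
      (eval₂ (Int.castRingHom ℚ_[p]) u Q / eval₂ (Int.castRingHom ℚ_[p]) u P) := by
  have h1 : (P : PowerSeries ℤ) * PowerSeries.invOfUnit (P : PowerSeries ℤ) 1 = 1 := by
    apply PowerSeries.mul_invOfUnit
    simp [← PowerSeries.coeff_zero_eq_constantCoeff_apply, hP]
  have h2 := ev_mul hu (P : PowerSeries ℤ) (PowerSeries.invOfUnit (P : PowerSeries ℤ) 1)
  have h3 := ev_poly u (1 : ℤ[X])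
  rw [h1, ev_poly] at h2
  rw [Polynomial.coe_one, eval₂_one] at h3
  rw [h3] at h2
  have h4 := ev_mul hu (Q : PowerSeries ℤ) (PowerSeries.invOfUnit (P : PowerSeries ℤ) 1)
  rw [ev_poly] at h4
  rw [eq_inv_of_mul_eq_one_right h2] at h4
  rw [div_eq_mul_inv, h4]
  exact (ev_summable hu _).of_norm.hasSum

/-- divisibility of coefficients -/
theorem coeff_dvd (W : ℤ[X]) (q : ℤ) (k0 : ℕ) (hW : ∀ i, q ^ i ∣ W.coeff i)
    (E : PowerSeries ℤ) (j : ℕ) :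
    q ^ (k0 - j) ∣ PowerSeries.coeff j (((reflect k0 W : ℤ[X]) : PowerSeries ℤ) * E) := by
  rw [PowerSeries.coeff_mul]
  apply Finset.dvd_sum
  intro x hx
  have hx' := Finset.HasAntidiagonal.mem_antidiagonal.mp hx
  apply Dvd.dvd.mul_right
  rw [Polynomial.coeff_coe, coeff_reflect]
  by_cases h : x.1 ≤ k0
  · rw [revAt_le h]
    exact (pow_dvd_pow q (by omega)).trans (hW _)
  · have : k0 - j = 0 := by omega
    simp [this]
end

theorem den_cop (a N : ℕ) (hN : 1 ≤ N) (h : Nat.gcd a N = 1) : ((a:ℚ)/(N:ℚ)).den = N := by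
  have := Rat.den_div_eq_of_coprime (a := (a:ℤ)) (b := (N:ℤ)) (by omega) (by simpa using h)
  have h2 : ((((a:ℤ):ℚ)/((N:ℤ):ℚ)).den : ℤ) = N := this
  simpa using h2

theorem fiber_card (N : ℕ) (hN : 2 ≤ N) (Z : Finset ℚ)
    (hZ : ∀ a : ℕ, 1 ≤ a → a ≤ N → Nat.gcd a N = 1 → (a:ℚ)/(N:ℚ) ∈ Z)
    (hZ2 : ∀ x ∈ Z, x.den = N → ∃ a : ℕ, a ≤ N ∧ Nat.gcd a N = 1 ∧ x = (a:ℚ)/(N:ℚ)) :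
    (Z.filter (fun x => x.den = N)).card = N.totient := by
  rw [Nat.totient]
  symm
  apply Finset.card_bij (fun (a : ℕ) _ => (a:ℚ)/(N:ℚ))
  · intro a ha
    simp only [Finset.mem_filter, Finset.mem_range] at ha ⊢
    have h1 : a ≠ 0 := by
      rintro rfl
      have := ha.2
      simp at this; omega
    refine ⟨hZ a (by omega) ha.1.le ha.2.symm, ?_⟩
    exact den_cop a N (by omega) ha.2.symm
  · intro a _ b _ h
    have hN0 : (N:ℚ) ≠ 0 := by positivity
    field_simp at h
    exact_mod_cast h
  · intro x hx
    simp only [Finset.mem_filter, Finset.mem_range] at hx ⊢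
    obtain ⟨a, h1, h2, h3⟩ := hZ2 x hx.1 hx.2
    refine ⟨a, ⟨lt_of_le_of_ne h1 ?_, Nat.Coprime.symm h2⟩, h3.symm⟩
    rintro rfl
    simp at h2; omega

/-- Combinatorics of `Z`. -/
theorem Z_facts_s16 (q : ℕ) (hq : 2 ≤ q) (Ψ : Finset ℕ) (hΨ : ∀ b ∈ Ψ, 1 ≤ b) (Z : Finset ℚ)
    (hZ : ∀ x : ℚ, x ∈ Z ↔ ∃ a b : ℕ, b ∈ Ψ ∧ 1 ≤ a ∧ a ≤ q * b ∧
      Nat.gcd a (q * b) = 1 ∧ x = (a : ℚ) / ((q * b : ℕ) : ℚ)) :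
    Z.card = ∑ b ∈ Ψ, (q * b).totient ∧
    ∏ x ∈ Z, x.den = ∏ b ∈ Ψ, (q * b) ^ (q * b).totient ∧
    ∀ x ∈ Z, q ∣ x.den := by
  have hden : ∀ x ∈ Z, ∃ b ∈ Ψ, x.den = q * b := by
    intro x hx
    obtain ⟨a, b, hb, h1, h2, h3, h4⟩ := (hZ x).1 hx
    refine ⟨b, hb, ?_⟩
    rw [h4]; exact den_cop a _ (Nat.mul_pos (by omega) (hΨ b hb)) h3
  have hmaps : ∀ x ∈ Z, x.den / q ∈ Ψ := by
    intro x hx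
    obtain ⟨b, hb, h⟩ := hden x hx
    rwa [h, Nat.mul_div_cancel_left _ (by omega)]
  have hfib : ∀ b ∈ Ψ, Z.filter (fun x => x.den / q = b) = Z.filter (fun x => x.den = q * b) := by
    intro b hb
    apply Finset.filter_congr
    intro x hx
    obtain ⟨c, hc, h⟩ := hden x hx
    rw [h, Nat.mul_div_cancel_left _ (by omega)]
    constructor
    · rintro rfl; rfl
    · intro h; exact Nat.eq_of_mul_eq_mul_left (by omega) h
  have hcard : ∀ b ∈ Ψ, (Z.filter (fun x => x.den = q * b)).card = (q * b).totient := by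
    intro b hb
    have hb1 := hΨ b hb
    apply fiber_card
    · nlinarith
    · intro a h1 h2 h3
      exact (hZ _).2 ⟨a, b, hb, h1, h2, h3, rfl⟩
    · intro x hx hxd
      obtain ⟨a, c, hc, h1, h2, h3, h4⟩ := (hZ x).1 hx
      have := den_cop a _ (Nat.mul_pos (by omega) (hΨ c hc)) h3
      rw [← h4, hxd] at this
      rw [this]
      exact ⟨a, h2, h3, h4⟩
  refine ⟨?_, ?_, ?_⟩
  · rw [Finset.card_eq_sum_card_fiberwise hmaps]
    apply Finset.sum_congr rfl
    intro b hb
    rw [hfib b hb, hcard b hb]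
  · rw [← Finset.prod_fiberwise_of_maps_to hmaps]
    apply Finset.prod_congr rfl
    intro b hb
    rw [hfib b hb, ← hcard b hb]
    apply Finset.prod_eq_pow_card
    intro x hx
    exact (Finset.mem_filter.1 hx).2
  · intro x hx
    obtain ⟨b, hb, h⟩ := hden x hx
    exact ⟨b, h⟩

open Polynomial in
/-- Integer polynomial with the numerator. -/
theorem num_poly {K : Type*} [Field K] [CharZero K] (q : ℕ) (Z : Finset ℚ)
    (hq : ∀ x ∈ Z, q ∣ x.den) (θ : ℚ) (hθ : θ ∈ Z) (n r : ℕ) (hr : r ≤ n) :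
    ∃ W : ℤ[X], W.natDegree ≤ r + n * (Z.card - 1) ∧ (∀ i, (q:ℤ) ^ i ∣ W.coeff i) ∧
      ∀ t : K, eval₂ (Int.castRingHom K) t W = ((∏ x ∈ Z, x.den : ℕ) : K) ^ n *
        ((∏ j ∈ Finset.range r, (t + (θ : K) + (j : K))) *
        (∏ θ ∈ Z.erase θ, ∏ j ∈ Finset.range n, (t + (θ : K) + (j : K)))) := by
  let f : ℚ → ℕ → ℤ[X] := fun x j => C ((x.den / q : ℕ) : ℤ) * X + C (x.num + j * x.den)
  have hf : ∀ x j, (f x j).natDegree ≤ 1 := fun x j => natDegree_linear_le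
  let W' : ℤ[X] := C ((θ.den : ℤ) ^ (n - r)) * ((∏ j ∈ Finset.range r, f θ j) *
    ∏ x ∈ Z.erase θ, ∏ j ∈ Finset.range n, f x j)
  refine ⟨W'.comp (C (q:ℤ) * X), ?_, ?_, ?_⟩
  · refine natDegree_comp_le.trans ?_
    have h1 : (C (q:ℤ) * X).natDegree ≤ 1 := (natDegree_C_mul_le _ _).trans natDegree_X_le
    have h2 : W'.natDegree ≤ r + n * (Z.card - 1) := by
      refine (natDegree_C_mul_le _ _).trans (natDegree_mul_le.trans (add_le_add ?_ ?_))
      · refine (natDegree_prod_le _ _).trans ?_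
        refine (Finset.sum_le_card_nsmul _ _ 1 (fun j _ => hf _ _)).trans ?_
        simp
      · refine (natDegree_prod_le _ _).trans ?_
        refine (Finset.sum_le_card_nsmul _ _ n (fun x _ => ?_)).trans ?_
        · refine (natDegree_prod_le _ _).trans ?_
          refine (Finset.sum_le_card_nsmul _ _ 1 (fun j _ => hf _ _)).trans ?_
          simp
        · rw [Finset.card_erase_of_mem hθ, smul_eq_mul, mul_comm]
    calc _ ≤ W'.natDegree * 1 := Nat.mul_le_mul_left _ h1
      _ ≤ _ := by simpa using h2
  · intro i
    rw [comp_C_mul_X_coeff]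
    exact Dvd.intro_left _ rfl
  · intro t
    have hev : ∀ x ∈ Z, ∀ j : ℕ, eval₂ (Int.castRingHom K) t ((f x j).comp (C (q:ℤ) * X)) =
        (x.den : K) * (t + (x : K) + (j : K)) := by
      intro x hx j
      obtain ⟨c, hc⟩ := hq x hx
      have hd : x.den ≠ 0 := x.den_nz
      have hq0 : 0 < q := by
        rcases Nat.eq_zero_or_pos q with h | h
        · rw [h, zero_mul] at hc; exact absurd hc hd
        · exact h
      have hdk : (x.den : K) ≠ 0 := by exact_mod_cast hd
      have h2 : (x : K) * x.den = x.num := by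
        rw [Rat.cast_def]; field_simp
      have h3 : (x.den / q : ℕ) = c := by rw [hc, Nat.mul_div_cancel_left _ hq0]
      have h4 : (x.den : K) = q * c := by exact_mod_cast congrArg (Nat.cast : ℕ → K) hc
      simp only [f, h3, add_comp, mul_comp, C_comp, X_comp, eval₂_add, eval₂_mul, eval₂_C, eval₂_X]
      simp only [eq_intCast]
      push_cast
      linear_combination (-1:K) * h2 - t * h4
    have hW : eval₂ (Int.castRingHom K) t (W'.comp (C (q:ℤ) * X)) =
        (θ.den : K) ^ (n - r) * ((∏ j ∈ Finset.range r, ((θ.den : K) * (t + (θ : K) + (j : K)))) *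
        ∏ x ∈ Z.erase θ, ∏ j ∈ Finset.range n, ((x.den : K) * (t + (x : K) + (j : K)))) := by
      simp only [W', mul_comp, prod_comp, eval₂_mul, eval₂_finsetProd]
      congr 1
      · rw [C_comp, eval₂_C]; simp
      · congr 1
        · exact Finset.prod_congr rfl fun j _ => hev θ hθ j
        · exact Finset.prod_congr rfl fun x hx => Finset.prod_congr rfl fun j _ =>
            hev x (Finset.mem_of_mem_erase hx) j
    rw [hW, ← Finset.mul_prod_erase Z _ hθ]
    simp only [Finset.prod_mul_distrib, Finset.prod_const, Finset.card_range, Nat.cast_mul,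
      Nat.cast_prod, mul_pow, Finset.prod_pow]
    have h5 : (θ.den : K) ^ n = (θ.den : K) ^ (n - r) * (θ.den : K) ^ r := by
      rw [← pow_add, Nat.sub_add_cancel hr]
    rw [h5]
    ring

open Polynomial in
/-- Lemma 6.2: expansion of `R_n(t)` at infinity.
With `k₀ = n|𝒵_B| - θ_min n - 1`, there are integers `h_k` (for `k ≥ (n+1)s - k₀`)
such that `R_n(t) = ∑_{k ≥ (n+1)s-k₀} h_k t^{-k}` for `|t|_p > 1` and
`v_p(h_k) ≥ sn/(p-1) - (log(n+1)/log p)(s-|𝒵_B|) + l_p·max{0,(n+1)s-k}`. -/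
theorem Rn_expansion_at_infinity
    (p : ℕ) [Fact p.Prime] (B : ℝ) (Ψ : Finset ℕ)
    (hΨ : ∀ b : ℕ, b ∈ Ψ ↔ 1 ≤ b ∧ ((p ^ ellp p * b).totient : ℝ) ≤ B)
    (bmax : ℕ) (hbmem : bmax ∈ Ψ) (hbmax : ∀ b ∈ Ψ, b ≤ bmax)
    (Z : Finset ℚ)
    (hZ : ∀ x : ℚ, x ∈ Z ↔ ∃ a b : ℕ, b ∈ Ψ ∧ 1 ≤ a ∧ a ≤ p ^ ellp p * b ∧
      Nat.gcd a (p ^ ellp p * b) = 1 ∧ x = (a : ℚ) / ((p ^ ellp p * b : ℕ) : ℚ))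
    (s : ℕ) (hsodd : Odd s) (hscard : Z.card + 1 < s)
    (n : ℕ) (hnprime : (n + 1).Prime)
    (hndvd : ((Ψ.biUnion fun b => (p ^ ellp p * b).primeFactors).lcm (fun q => q - 1)) *
      p ^ ellp p * bmax ∣ n)
    (hdeg : (2 : ℤ) ≤ ((n : ℤ) + 1) * s - n * ((Z.card : ℤ) - 1) -
      (((p ^ ellp p * bmax - 1) * n / (p ^ ellp p * bmax) : ℕ) : ℤ) + 1)
 :
    ∃ h : ℕ → ℤ,
      (∀ t : ℚ_[p], 1 < ‖t‖ →
        HasSum (fun j : ℕ =>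
            (h (j + ((n + 1) * s - (n * Z.card - n / (p ^ ellp p * bmax) - 1))) : ℚ_[p]) *
              t ^ (-((j + ((n + 1) * s - (n * Z.card - n / (p ^ ellp p * bmax) - 1))) : ℤ)))
          (RfunP p Ψ Z bmax s n t)) ∧
      (∀ k : ℕ, (n + 1) * s - (n * Z.card - n / (p ^ ellp p * bmax) - 1) ≤ k →
        h k ≠ 0 →
          ((s : ℝ) * n / ((p : ℝ) - 1) -
              (Real.log ((n : ℝ) + 1) / Real.log p) * ((s : ℝ) - Z.card) +
              (ellp p : ℝ) * max 0 ((((n + 1) * s : ℕ) : ℝ) - (k : ℝ)))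
            ≤ (padicValInt p (h k) : ℝ)) := by
  classical
  have hp : p.Prime := Fact.out
  set q := p ^ ellp p with hq
  have hl : 1 ≤ ellp p := by unfold ellp; split_ifs <;> omega
  have hq2 : 2 ≤ q := hp.two_le.trans (Nat.le_self_pow (by omega) p)
  have hpq : p ∣ q := dvd_pow_self p (by omega)
  have hΨ1 : ∀ b ∈ Ψ, 1 ≤ b := fun b hb => ((hΨ b).1 hb).1
  have hb1 := hΨ1 bmax hbmem
  obtain ⟨hZcard, hZden, hZq⟩ := Z_facts_s16 q hq2 Ψ hΨ1 Z hZ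
  set N := q * bmax with hN
  have hN2 : 2 ≤ N := by nlinarith
  have hn0 : 0 < n := by
    have := hnprime.two_le
    omega
  obtain ⟨c, hc⟩ : N ∣ n := by
    refine Dvd.dvd.trans ?_ hndvd
    rw [mul_assoc]
    exact Dvd.intro_left _ rfl
  have hc1 : 1 ≤ c := by
    rcases Nat.eq_zero_or_pos c with h | h
    · rw [h, mul_zero] at hc; omega
    · exact h
  have hnN : n / N = c := by rw [hc, Nat.mul_div_cancel_left _ (by omega)]
  have hm : (N - 1) * n / N = (N - 1) * c := by
    rw [hc, mul_left_comm, Nat.mul_div_cancel_left _ (by omega)]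
  have hmc : (N - 1) * c + c = n := by
    rw [hc, ← Nat.succ_mul, Nat.succ_eq_add_one, Nat.sub_add_cancel (by omega)]
  have hm1 : 1 ≤ (N - 1) * c := Nat.mul_pos (by omega) hc1
  set m := (N - 1) * c with hmdef
  set z := Z.card with hz
  have hθ : ((N : ℚ) - 1) / (N : ℚ) ∈ Z := by
    refine (hZ _).2 ⟨N - 1, bmax, hbmem, by omega, Nat.sub_le _ _, ?_, ?_⟩
    · show Nat.gcd (N - 1) N = 1
      have h := (Nat.coprime_self_add_right (m := N - 1) (n := 1)).2 (by simp)
      rwa [Nat.sub_add_cancel (by omega)] at h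
    · rw [Nat.cast_sub (by omega), Nat.cast_one]
  have hz1 : 1 ≤ z := Finset.card_pos.2 ⟨_, hθ⟩
  obtain ⟨W, hWdeg, hWdvd, hWev⟩ := num_poly (K := ℚ_[p]) q Z hZq _ hθ n (m - 1) (by omega)
  set k0 := m - 1 + n * (z - 1) with hk0
  have hnz : n * (z - 1) + n = n * z := by
    rw [← Nat.mul_succ, Nat.succ_eq_add_one, Nat.sub_add_cancel hz1]
  have hk0' : n * z - n / N - 1 = k0 := by
    rw [hnN]; omega
  have hlt : k0 < (n + 1) * s := by
    have h1 : k0 ≤ n * z := by omega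
    have h2 : n * z ≤ n * s := Nat.mul_le_mul_left _ (by omega)
    have h3 : (n + 1) * s = n * s + s := by ring
    omega
  have hexp : ((n : ℤ) + 1) * s - ((n : ℤ) * z - (n : ℤ) / ((p : ℤ) ^ ellp p * (bmax : ℤ)) - 1)
      = (((n + 1) * s - k0 : ℕ) : ℤ) := by
    have h1 : (n : ℤ) / ((p : ℤ) ^ ellp p * (bmax : ℤ)) = c := by
      have : ((p : ℤ) ^ ellp p * (bmax : ℤ)) = (N : ℤ) := by rw [hN, hq]; push_cast; rfl
      rw [this, ← hnN]; push_cast; rfl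
    have h2 : (k0 : ℤ) + c + 1 = n * z := by
      have : k0 + c + 1 = n * z := by omega
      exact_mod_cast this
    rw [h1, Nat.cast_sub hlt.le]
    push_cast
    linarith
  rw [hk0']
  set K0 := (n + 1) * s - k0 with hK0
  set A2 : ℕ := ∏ b ∈ Ψ, ∏ r ∈ (q * b).primeFactors, r ^ ((q * b).totient / (r - 1)) with hA2
  obtain ⟨d, hd⟩ : (m - 1).factorial ∣ n.factorial := Nat.factorial_dvd_factorial (by omega)
  let P : ℤ[X] := (∏ j ∈ Finset.range (n + 1), (1 + C (j : ℤ) * X)) ^ s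
  have hP : P.coeff 0 = 1 := by
    rw [coeff_zero_eq_eval_zero]
    simp [P, eval_prod]
  let Cc : ℕ := A2 ^ n * n.factorial ^ (s - z) * d
  let F : PowerSeries ℤ := ((reflect k0 W : ℤ[X]) : PowerSeries ℤ) *
      PowerSeries.invOfUnit (P : PowerSeries ℤ) 1
  refine ⟨fun k => (Cc : ℤ) * PowerSeries.coeff (k - K0) F, ?_, ?_⟩
  · intro t ht
    have ht0 : t ≠ 0 := by
      rintro rfl
      simp at ht
      linarith
    have hu : ‖t⁻¹‖ < 1 := by
      rw [norm_inv]; exact inv_lt_one_of_one_lt₀ ht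
    have hs := (ev_main hu (reflect k0 W) P hP).mul_left ((Cc : ℚ_[p]) * t⁻¹ ^ K0)
    have hfun : (fun i => (Cc : ℚ_[p]) * t⁻¹ ^ K0 * (((PowerSeries.coeff i F : ℤ) : ℚ_[p]) * t⁻¹ ^ i))
        = (fun j : ℕ => (((Cc : ℤ) * PowerSeries.coeff (j + K0 - K0) F : ℤ) : ℚ_[p]) *
          t ^ (-((j : ℤ) + (((n : ℤ) + 1) * s - ((n : ℤ) * z - (n : ℤ) / ((p : ℤ) ^ ellp p * (bmax : ℤ)) - 1))))) := by
      funext j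
      rw [Nat.add_sub_cancel]
      have h1 : (-((j : ℤ) + (((n : ℤ) + 1) * s - ((n : ℤ) * z - (n : ℤ) / ((p : ℤ) ^ ellp p * (bmax : ℤ)) - 1)))) = -((j + K0 : ℕ) : ℤ) := by
        rw [hexp]; push_cast; ring
      rw [h1, zpow_neg, zpow_natCast, pow_add, inv_pow, inv_pow]
      push_cast
      field_simp
    have hval : (Cc : ℚ_[p]) * t⁻¹ ^ K0 * (eval₂ (Int.castRingHom ℚ_[p]) t⁻¹ (reflect k0 W) /
        eval₂ (Int.castRingHom ℚ_[p]) t⁻¹ P) = RfunP p Ψ Z bmax s n t := by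
      symm
      let := invertibleOfNonzero ht0
      have hQ := eval₂_reflect_mul_pow (Int.castRingHom ℚ_[p]) t k0 W hWdeg
      rw [invOf_eq_inv, hWev t, hZden] at hQ
      have hPe : eval₂ (Int.castRingHom ℚ_[p]) t⁻¹ P * t ^ ((n + 1) * s) =
          (∏ j ∈ Finset.range (n + 1), (t + (j : ℚ_[p]))) ^ s := by
        simp only [P, eval₂_pow, eval₂_finsetProd]
        rw [pow_mul, ← mul_pow]
        congr 1
        have : t ^ (n + 1) = ∏ j ∈ Finset.range (n + 1), t := by simp
        rw [this, ← Finset.prod_mul_distrib]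
        apply Finset.prod_congr rfl
        intro j _
        rw [eval₂_add, eval₂_mul, eval₂_C, eval₂_X, eval₂_one]
        simp only [eq_intCast, Int.cast_natCast]
        field_simp
      have hsplit : t ^ ((n + 1) * s) = t ^ K0 * t ^ k0 := by
        rw [← pow_add, hK0, Nat.sub_add_cancel hlt.le]
      simp only [RfunP]
      rw [← hq, ← hN, hm, ← hPe, hsplit, ← hz, ← hA2]
      have hfac : (n.factorial : ℚ_[p]) ^ (s - z + 1) / ((m - 1).factorial : ℚ_[p]) =
          (n.factorial : ℚ_[p]) ^ (s - z) * d := by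
        have h0 : ((m - 1).factorial : ℚ_[p]) ≠ 0 := by exact_mod_cast Nat.factorial_ne_zero _
        rw [pow_succ, div_eq_iff h0]
        nth_rewrite 2 [hd]
        push_cast
        ring
      rw [hfac]
      set E1 := eval₂ (Int.castRingHom ℚ_[p]) t⁻¹ (reflect k0 W)
      set E2 := eval₂ (Int.castRingHom ℚ_[p]) t⁻¹ P
      have hCc : (Cc : ℚ_[p]) = (A2 : ℚ_[p]) ^ n * (n.factorial : ℚ_[p]) ^ (s - z) * d := by
        simp only [Cc]; push_cast; rfl
      have hnum : ∀ a b c x y : ℚ_[p], a * b * c * x * y = b * c * (a * (x * y)) := by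
        intros; ring
      rw [hnum, ← hQ, hCc, inv_pow]
      by_cases hE : E2 = 0
      · simp [hE]
      · field_simp
    rw [← hfun, ← hval]
    exact hs
  · intro k hk hne
    set j := k - K0 with hj
    have hkj : k = K0 + j := by omega
    set S := ∑ b ∈ Ψ, (q * b).totient / (p - 1) with hS
    have hpS : (p - 1) * S = z := by
      rw [hS, Finset.mul_sum, hZcard]
      apply Finset.sum_congr rfl
      intro b hb
      apply Nat.mul_div_cancel'
      rw [← Nat.totient_prime hp]
      exact Nat.totient_dvd_of_dvd (hpq.mul_right b)
    have hA2d : p ^ S ∣ A2 := by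
      rw [hS, ← Finset.prod_pow_eq_pow_sum]
      apply Finset.prod_dvd_prod_of_dvd
      intro b hb
      have hmem : p ∈ (q * b).primeFactors := by
        rw [Nat.mem_primeFactors]
        exact ⟨hp, hpq.mul_right b, Nat.mul_ne_zero (by omega) (by have := hΨ1 b hb; omega)⟩
      exact Finset.dvd_prod_of_mem (fun r => r ^ ((q * b).totient / (r - 1))) hmem
    set v := padicValNat p n.factorial with hv
    have hvd : p ^ v ∣ n.factorial := pow_padicValNat_dvd
    have hCd : p ^ (S * n + v * (s - z)) ∣ Cc := by
      rw [pow_add, pow_mul, pow_mul]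
      exact Dvd.dvd.mul_right (mul_dvd_mul (pow_dvd_pow_of_dvd hA2d n)
        (pow_dvd_pow_of_dvd hvd _)) d
    have hFd : (p : ℤ) ^ (ellp p * (k0 - j)) ∣ PowerSeries.coeff j F := by
      have := coeff_dvd W (q : ℤ) k0 hWdvd (PowerSeries.invOfUnit (P : PowerSeries ℤ) 1) j
      rw [hq] at this
      push_cast at this
      rwa [← pow_mul] at this
    have hall : (p : ℤ) ^ (S * n + v * (s - z) + ellp p * (k0 - j)) ∣
        (Cc : ℤ) * PowerSeries.coeff j F := by
      rw [pow_add]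
      exact mul_dvd_mul (by exact_mod_cast hCd) hFd
    have hval := ((padicValInt_dvd_iff _ _).1 hall).resolve_left hne
    refine le_trans ?_ (Nat.cast_le.2 hval)
    have hvr := aux_fact p n
    rw [← hv] at hvr
    have hp2 : (2 : ℝ) ≤ p := by exact_mod_cast hp.two_le
    have hpSr : (S : ℝ) = z / ((p : ℝ) - 1) := by
      rw [eq_div_iff (by linarith), ← hpS]
      push_cast [Nat.cast_sub hp.one_le]
      ring
    have hszr : ((s - z : ℕ) : ℝ) = (s : ℝ) - z := by rw [Nat.cast_sub (by omega)]
    have hsz0 : (0 : ℝ) ≤ (s : ℝ) - z := by rw [← hszr]; positivity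
    have hmax : max 0 ((((n + 1) * s : ℕ) : ℝ) - (k : ℝ)) = ((k0 - j : ℕ) : ℝ) := by
      have h1 : (n + 1) * s = K0 + k0 := by omega
      rw [h1, hkj]
      push_cast
      rcases le_total j k0 with h | h
      · rw [Nat.cast_sub h, max_eq_right]
        · ring
        · have : (j : ℝ) ≤ k0 := by exact_mod_cast h
          linarith
      · rw [Nat.sub_eq_zero_of_le h, max_eq_left]
        · simp
        · have : (k0 : ℝ) ≤ j := by exact_mod_cast h
          linarith
    rw [hmax]
    rw [Nat.cast_add, Nat.cast_add, Nat.cast_mul, Nat.cast_mul, Nat.cast_mul, hszr, hpSr]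
    have := mul_le_mul_of_nonneg_right hvr hsz0
    have h6 : (s : ℝ) * n / ((p : ℝ) - 1) = z / ((p : ℝ) - 1) * n + n / ((p : ℝ) - 1) * (s - z) := by
      ring
    rw [h6]
    linarith
end

section
/- With the standing setup (prime p, l_p, B, Ψ_B, 𝒵_B, b_max, θ_max, A_1(B), A_2(B), P_B, I, odd s, n ∈ I, the rational function R_n and its partial fraction coefficients r_{i,k}), for every i ∈ {1, 2, …, s} and every k ∈ {0, 1, …, n} one has the Archimedean bound |r_{i,k}| ≤ A_1(B)^n · A_2(B)^n · 2^{(s − |𝒵_B| + 2)n} · (2 p^{l_p} b_max)^{3s} · n^{2s}. -/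
open Polynomial in
/-- Truncated weighted `ℓ¹` norm of a polynomial. -/
noncomputable def wnorm (e : ℚ) (s : ℕ) (F : ℚ[X]) : ℚ :=
  ∑ m ∈ Finset.range s, |F.coeff m| * e ^ m

open Polynomial in
lemma wnorm_nonneg (e : ℚ) (he : 0 ≤ e) (s : ℕ) (F : ℚ[X]) : 0 ≤ wnorm e s F :=
  Finset.sum_nonneg fun _ _ => by positivity

open Polynomial in
lemma wnorm_shift (e : ℚ) (he : 0 ≤ e) (s : ℕ) (F : ℚ[X]) :
    wnorm e s (F * X) ≤ e * wnorm e s F := by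
  unfold wnorm
  cases s with
  | zero => simp
  | succ s =>
    rw [Finset.sum_range_succ', Finset.mul_sum, Finset.sum_range_succ]
    simp only [coeff_mul_X, coeff_mul_X_zero, abs_zero, zero_mul, add_zero]
    have h1 : ∑ m ∈ Finset.range s, |F.coeff m| * e ^ (m + 1)
        = ∑ m ∈ Finset.range s, e * (|F.coeff m| * e ^ m) :=
      Finset.sum_congr rfl fun m _ => by ring
    have h2 : 0 ≤ e * (|F.coeff s| * e ^ s) := by positivity
    linarith

open Polynomial in
lemma wnorm_mul_C (e : ℚ) (s : ℕ) (F : ℚ[X]) (c : ℚ) :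
    wnorm e s (F * C c) = |c| * wnorm e s F := by
  unfold wnorm
  rw [Finset.mul_sum]
  refine Finset.sum_congr rfl fun m _ => ?_
  rw [coeff_mul_C, abs_mul]; ring

open Polynomial in
lemma wnorm_add_le (e : ℚ) (he : 0 ≤ e) (s : ℕ) (F G : ℚ[X]) :
    wnorm e s (F + G) ≤ wnorm e s F + wnorm e s G := by
  unfold wnorm
  rw [← Finset.sum_add_distrib]
  refine Finset.sum_le_sum fun m _ => ?_
  rw [coeff_add, ← add_mul]
  exact mul_le_mul_of_nonneg_right (abs_add_le _ _) (by positivity)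

open Polynomial in
lemma wnorm_neg (e : ℚ) (s : ℕ) (F : ℚ[X]) : wnorm e s (-F) = wnorm e s F := by
  simp [wnorm]

open Polynomial in
lemma wnorm_lin_upper (e : ℚ) (he : 0 ≤ e) (s : ℕ) (F : ℚ[X]) (c : ℚ) :
    wnorm e s (F * (X + C c)) ≤ (|c| + e) * wnorm e s F := by
  rw [mul_add]
  have h1 := wnorm_add_le e he s (F * X) (F * C c)
  have h2 := wnorm_shift e he s F
  rw [wnorm_mul_C] at h1
  linarith

open Polynomial in
lemma wnorm_lin_lower (e : ℚ) (he : 0 ≤ e) (s : ℕ) (F : ℚ[X]) (c : ℚ) :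
    (|c| - e) * wnorm e s F ≤ wnorm e s (F * (X + C c)) := by
  have h1 := wnorm_add_le e he s (F * (X + C c)) (-(F * X))
  have h2 := wnorm_shift e he s F
  rw [wnorm_neg, show F * (X + C c) + -(F * X) = F * C c by ring, wnorm_mul_C] at h1
  linarith

open Polynomial in
lemma wnorm_prod_upper {ι : Type*} (e : ℚ) (he : 0 ≤ e) (s : ℕ) (F : ℚ[X]) (S : Finset ι)
    (c u : ι → ℚ) (hu : ∀ j ∈ S, |c j| + e ≤ u j) :
    wnorm e s (F * ∏ j ∈ S, (X + C (c j))) ≤ (∏ j ∈ S, u j) * wnorm e s F := by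
  classical
  induction S using Finset.induction_on with
  | empty => simp
  | insert a S ha ih =>
    rw [Finset.prod_insert ha, Finset.prod_insert ha,
      show F * ((X + C (c a)) * ∏ j ∈ S, (X + C (c j)))
        = (F * ∏ j ∈ S, (X + C (c j))) * (X + C (c a)) by ring]
    refine (wnorm_lin_upper e he s _ _).trans ?_
    have h1 := ih fun j hj => hu j (Finset.mem_insert_of_mem hj)
    have h2 := hu a (Finset.mem_insert_self _ _)
    have h3 : 0 ≤ |c a| + e := by positivity
    rw [mul_assoc]
    exact mul_le_mul h2 h1 (wnorm_nonneg e he s _) (h3.trans h2)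

open Polynomial in
lemma wnorm_prod_lower {ι : Type*} (e : ℚ) (he : 0 ≤ e) (s : ℕ) (F : ℚ[X]) (S : Finset ι)
    (c : ι → ℚ) (hu : ∀ j ∈ S, 0 ≤ |c j| - e) :
    (∏ j ∈ S, (|c j| - e)) * wnorm e s F ≤ wnorm e s (F * ∏ j ∈ S, (X + C (c j))) := by
  classical
  induction S using Finset.induction_on with
  | empty => simp
  | insert a S ha ih =>
    rw [Finset.prod_insert ha, Finset.prod_insert ha,
      show F * ((X + C (c a)) * ∏ j ∈ S, (X + C (c j)))
        = (F * ∏ j ∈ S, (X + C (c j))) * (X + C (c a)) by ring]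
    refine le_trans ?_ (wnorm_lin_lower e he s _ _)
    have h1 := ih fun j hj => hu j (Finset.mem_insert_of_mem hj)
    rw [mul_assoc]
    exact mul_le_mul_of_nonneg_left h1 (hu a (Finset.mem_insert_self _ _))

open Polynomial in
lemma wnorm_prod_pow_lower {ι : Type*} (e : ℚ) (he : 0 ≤ e) (s : ℕ) (F : ℚ[X]) (S : Finset ι)
    (c : ι → ℚ) (hu : ∀ j ∈ S, 0 ≤ |c j| - e) (w : ℕ) :
    (∏ j ∈ S, (|c j| - e)) ^ w * wnorm e s F
      ≤ wnorm e s (F * (∏ j ∈ S, (X + C (c j))) ^ w) := by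
  induction w with
  | zero => simp
  | succ w ih =>
    rw [pow_succ, pow_succ, ← mul_assoc F]
    refine le_trans ?_ (wnorm_prod_lower e he s _ S c hu)
    have := mul_le_mul_of_nonneg_left ih (Finset.prod_nonneg hu)
    linarith

open Polynomial in
lemma wnorm_prod_prod_upper {ι κ : Type*} (e : ℚ) (he : 0 ≤ e) (s : ℕ) (F : ℚ[X]) (T : Finset κ)
    (S : Finset ι) (c : κ → ι → ℚ) (u : ι → ℚ) (hu : ∀ a ∈ T, ∀ j ∈ S, |c a j| + e ≤ u j)
    (hu0 : ∀ j ∈ S, 0 ≤ u j) :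
    wnorm e s (F * ∏ a ∈ T, ∏ j ∈ S, (X + C (c a j)))
      ≤ (∏ j ∈ S, u j) ^ T.card * wnorm e s F := by
  classical
  induction T using Finset.induction_on with
  | empty => simp
  | insert a T ha ih =>
    rw [Finset.prod_insert ha, Finset.card_insert_of_notMem ha,
      mul_comm (∏ j ∈ S, (X + C (c a j))), ← mul_assoc]
    refine (wnorm_prod_upper e he s _ S (c a) u (hu a (Finset.mem_insert_self _ _))).trans ?_
    have h1 := ih fun b hb => hu b (Finset.mem_insert_of_mem hb)
    rw [pow_succ', mul_assoc]
    exact mul_le_mul_of_nonneg_left h1 (Finset.prod_nonneg hu0)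

open Polynomial in
lemma wnorm_congr (e : ℚ) (s : ℕ) (F W : ℚ[X]) : wnorm e s (F + X ^ s * W) = wnorm e s F := by
  unfold wnorm
  refine Finset.sum_congr rfl fun m hm => ?_
  rw [coeff_add, coeff_X_pow_mul', if_neg (by simpa using hm), add_zero]

open Polynomial in
lemma pf_identity (S : Finset ℕ) (k : ℕ) (hk : k ∈ S) (c : ℕ → ℚ) (hck : c k = 0) (s : ℕ)
    (Num : ℚ[X]) (r : ℕ → ℕ → ℚ)
    (h : ∀ x : ℚ, (∀ j ∈ S, x + c j ≠ 0) →
      Num.eval x / (∏ j ∈ S, (x + c j)) ^ s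
        = ∑ i ∈ Finset.Icc 1 s, ∑ j ∈ S, r i j / (x + c j) ^ i) :
    ∃ W : ℚ[X], Num = (∑ i ∈ Finset.Icc 1 s, C (r i k) * X ^ (s - i))
      * (∏ j ∈ S.erase k, (X + C (c j))) ^ s + X ^ s * W := by
  classical
  refine ⟨∑ i ∈ Finset.Icc 1 s, ∑ j ∈ S.erase k, C (r i j) *
    ((∏ j ∈ S.erase k, (X + C (c j))) ^ (s - i) *
      (∏ l ∈ (S.erase k).erase j, (X + C (c l))) ^ i), ?_⟩
  refine Polynomial.eq_of_infinite_eval_eq _ _ ?_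
  have hinf : (((S.image fun j => - c j) : Finset ℚ) : Set ℚ)ᶜ.Infinite :=
    (Finset.finite_toSet _).infinite_compl
  refine hinf.mono ?_
  intro x hx
  have hx' : ∀ j ∈ S, x + c j ≠ 0 := by
    intro j hj h0
    apply hx
    simp only [Finset.coe_image, Set.mem_image, Finset.mem_coe]
    exact ⟨j, hj, by linarith⟩
  have hx0 : x ≠ 0 := by simpa [hck] using hx' k hk
  have hE := h x hx'
  set E : ℚ := ∏ j ∈ S.erase k, (x + c j) with hEdef
  have hE0 : E ≠ 0 := Finset.prod_ne_zero_iff.2 fun j hj => hx' j (Finset.mem_of_mem_erase hj)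
  rw [← Finset.mul_prod_erase S _ hk, hck, add_zero, ← hEdef,
    div_eq_iff (by positivity)] at hE
  show Num.eval x = _
  rw [hE]
  simp only [eval_add, eval_mul, eval_finsetSum, eval_pow, eval_C, eval_X, eval_prod]
  rw [← hEdef, Finset.sum_mul, Finset.sum_mul, Finset.mul_sum, ← Finset.sum_add_distrib]
  refine Finset.sum_congr rfl fun i hi => ?_
  have his : s = (s - i) + i := by have := (Finset.mem_Icc.1 hi).2; omega
  rw [← Finset.add_sum_erase S _ hk, hck, add_zero, add_mul, Finset.sum_mul, Finset.mul_sum]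
  congr 1
  · have : x ^ s = x ^ (s - i) * x ^ i := by rw [← pow_add, ← his]
    rw [mul_pow, this]
    field_simp
  · refine Finset.sum_congr rfl fun j hj => ?_
    have hj0 := hx' j (Finset.mem_of_mem_erase hj)
    have h1 : E = (x + c j) * ∏ l ∈ (S.erase k).erase j, (x + c l) :=
      (Finset.mul_prod_erase _ _ hj).symm
    have h2 : E ^ s = E ^ (s - i) * E ^ i := by rw [← pow_add, ← his]
    have h3 : E ^ i = (x + c j) ^ i * (∏ l ∈ (S.erase k).erase j, (x + c l)) ^ i := by
      rw [← mul_pow, ← h1]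
    rw [mul_pow, h2, h3]
    field_simp

open Polynomial in
lemma coeff_P (s : ℕ) (a : ℕ → ℚ) (i : ℕ) (hi : i ∈ Finset.Icc 1 s) :
    (∑ i ∈ Finset.Icc 1 s, C (a i) * X ^ (s - i) : ℚ[X]).coeff (s - i) = a i := by
  rw [finsetSum_coeff, Finset.sum_eq_single i]
  · simp
  · intro b hb hbi
    rw [coeff_C_mul_X_pow, if_neg]
    simp only [Finset.mem_Icc] at hb hi
    omega
  · exact fun h => absurd hi h

open Polynomial in
lemma coeff_le_wnorm (e : ℚ) (he : 0 ≤ e) (s m : ℕ) (hm : m < s) (F : ℚ[X]) :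
    |F.coeff m| * e ^ m ≤ wnorm e s F :=
  Finset.single_le_sum (f := fun m => |F.coeff m| * e ^ m) (fun _ _ => by positivity)
    (Finset.mem_range.2 hm)

/-- majorant of `|θ + j - k| + ε`. -/
def uu (k j : ℕ) : ℕ := if j < k then k - j else j - k + 1

lemma uu_bound (e θ : ℚ) (h1 : e ≤ θ) (h2 : θ ≤ 1 - e) (k j : ℕ) :
    |θ + j - k| + e ≤ (uu k j : ℚ) := by
  unfold uu
  split_ifs with h
  · have : (j : ℚ) + 1 ≤ k := by exact_mod_cast h
    rw [Nat.cast_sub h.le]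
    rcases abs_cases (θ + j - k) with h | h <;> linarith
  · push Not at h
    have h' : (k : ℚ) ≤ j := by exact_mod_cast h
    push_cast [Nat.cast_sub h]
    rcases abs_cases (θ + j - k) with h | h <;> linarith

lemma prod_uu_le (k M : ℕ) (h : M ≤ k) : ∏ j ∈ Finset.range M, uu k j = k.descFactorial M := by
  rw [Nat.descFactorial_eq_prod_range]
  refine Finset.prod_congr rfl fun j hj => ?_
  have := Finset.mem_range.1 hj
  simp [uu, show j < k by omega]

lemma prod_uu_ge (k a : ℕ) :
    ∏ j ∈ Finset.range (k + a), uu k j = k.factorial * a.factorial := by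
  rw [Finset.prod_range_add, prod_uu_le k k le_rfl, Nat.descFactorial_self,
    ← Finset.prod_range_add_one_eq_factorial a]
  congr 1
  refine Finset.prod_congr rfl fun j hj => ?_
  simp [uu]

lemma prod_uu_bound (k M n : ℕ) (hk : k ≤ n) :
    ∏ j ∈ Finset.range M, uu k j ≤ M.factorial * 2 ^ n := by
  rcases le_total M k with h | h
  · rw [prod_uu_le k M h, Nat.descFactorial_eq_factorial_mul_choose]
    exact Nat.mul_le_mul_left _ ((Nat.choose_le_two_pow k M).trans
      (Nat.pow_le_pow_right (by norm_num) hk))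
  · obtain ⟨a, rfl⟩ := Nat.exists_eq_add_of_le h
    rw [prod_uu_ge]
    calc k.factorial * a.factorial ≤ (k + a).factorial :=
          Nat.le_of_dvd (Nat.factorial_pos _) (Nat.factorial_mul_factorial_dvd_factorial_add k a)
      _ ≤ (k + a).factorial * 2 ^ n := Nat.le_mul_of_pos_right _ (by positivity)

lemma den_half (e : ℚ) (he : e ≤ 1 / 2) (a n : ℕ) (hn : 1 ≤ n) (ha : a ≤ n) :
    (a.factorial : ℚ) ≤ 2 * n * ∏ d ∈ Finset.range a, ((d : ℚ) + 1 - e) := by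
  have hpos : ∀ b : ℕ, 0 ≤ ∏ d ∈ Finset.range b, ((d : ℚ) + 1 - e) := fun b =>
    Finset.prod_nonneg fun d _ => by
      have : (0 : ℚ) ≤ d := by positivity
      linarith
  have key : ∀ b : ℕ, ((b + 1).factorial : ℚ) ≤
      2 * ((b : ℚ) + 1) * ∏ d ∈ Finset.range (b + 1), ((d : ℚ) + 1 - e) := by
    intro b
    induction b with
    | zero => simp; linarith
    | succ b ih =>
      rw [Nat.factorial_succ, Finset.prod_range_succ]
      push_cast
      have h0 := hpos (b + 1)
      set Q := ∏ d ∈ Finset.range (b + 1), ((d : ℚ) + 1 - e)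
      have hb : (0 : ℚ) ≤ b := by positivity
      have h1 : ((b : ℚ) + 1) * Q ≤ Q * ((b : ℚ) + 1 + 1 - e) := by nlinarith
      have h2 : ((b : ℚ) + 1 + 1) * ((b + 1).factorial : ℚ)
          ≤ ((b : ℚ) + 1 + 1) * (2 * ((b : ℚ) + 1) * Q) :=
        mul_le_mul_of_nonneg_left ih (by positivity)
      have h3 : 2 * ((b : ℚ) + 1 + 1) * (((b : ℚ) + 1) * Q)
          ≤ 2 * ((b : ℚ) + 1 + 1) * (Q * ((b : ℚ) + 1 + 1 - e)) :=
        mul_le_mul_of_nonneg_left h1 (by positivity)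
      linarith
  have hn' : (1 : ℚ) ≤ n := by exact_mod_cast hn
  cases a with
  | zero => simp; linarith
  | succ b =>
    refine (key b).trans (mul_le_mul_of_nonneg_right ?_ (hpos _))
    have : (b : ℚ) + 1 ≤ n := by exact_mod_cast ha
    linarith

lemma den_bound (e : ℚ) (he : e ≤ 1 / 2) (k a : ℕ) (hn : 1 ≤ k + a) :
    (k.factorial : ℚ) * a.factorial ≤ 4 * ((k + a : ℕ) : ℚ) ^ 2 *
      ∏ j ∈ (Finset.range (k + a + 1)).erase k, (|(j : ℚ) - k| - e) := by
  have h1 := den_half e he k (k + a) hn (by omega)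
  have h2 := den_half e he a (k + a) hn (by omega)
  have h3 : ∏ j ∈ (Finset.range (k + a + 1)).erase k, (|(j : ℚ) - k| - e)
      = (∏ d ∈ Finset.range k, ((d : ℚ) + 1 - e)) * ∏ d ∈ Finset.range a, ((d : ℚ) + 1 - e) := by
    have hs : (Finset.range (k + a + 1)).erase k
        = Finset.range k ∪ (Finset.range a).image (fun d => k + 1 + d) := by
      ext j
      simp only [Finset.mem_erase, Finset.mem_range, Finset.mem_union, Finset.mem_image]
      constructor
      · rintro ⟨h, h'⟩
        rcases lt_or_gt_of_ne h with h | h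
        · exact Or.inl h
        · exact Or.inr ⟨j - (k + 1), by omega, by omega⟩
      · rintro (h | ⟨d, hd, rfl⟩) <;> omega
    rw [hs, Finset.prod_union, Finset.prod_image]
    · congr 1
      · rw [← Finset.prod_range_reflect]
        refine Finset.prod_congr rfl fun j hj => ?_
        have hj' := Finset.mem_range.1 hj
        have : ((k - 1 - j : ℕ) : ℚ) = k - 1 - j := by
          rw [Nat.cast_sub (by omega), Nat.cast_sub (by omega)]; simp
        rw [this, show (k : ℚ) - 1 - j - k = -(j + 1) by ring, abs_neg, abs_of_nonneg (by positivity)]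
      · refine Finset.prod_congr rfl fun j hj => ?_
        push_cast
        rw [show (k : ℚ) + 1 + j - k = j + 1 by ring, abs_of_nonneg (by positivity)]
    · intro x _ y _ h; simpa using h
    · rw [Finset.disjoint_left]
      intro j hj hj'
      simp only [Finset.mem_range, Finset.mem_image] at hj hj'
      obtain ⟨d, _, rfl⟩ := hj'
      omega
  rw [h3]
  refine (mul_le_mul h1 h2 (by positivity) ((Nat.cast_nonneg _).trans h1)).trans (le_of_eq ?_)
  ring

open Polynomial in
lemma core_bound (A : ℚ) (hA : 0 ≤ A) (Z : Finset ℚ) (θm : ℚ) (hθm : θm ∈ Z) (N : ℕ) (hN : 1 ≤ N)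
    (hθ : ∀ θ ∈ Z, 1 / (2 * N : ℚ) ≤ θ ∧ θ ≤ 1 - 1 / (2 * N : ℚ))
    (s n M : ℕ) (hs : Z.card + 1 < s) (hn : 1 ≤ n) (r : ℕ → ℕ → ℚ)
    (hr : ∀ t : ℚ, (∀ j ∈ Finset.range (n + 1), t + (j : ℚ) ≠ 0) →
      A * ((Nat.factorial n : ℚ) ^ (s - Z.card + 1) / (Nat.factorial M : ℚ)) *
        (∏ j ∈ Finset.range M, (t + θm + (j : ℚ))) *
        (∏ θ ∈ Z.erase θm, ∏ j ∈ Finset.range n, (t + θ + (j : ℚ))) /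
        (∏ j ∈ Finset.range (n + 1), (t + (j : ℚ))) ^ s =
        ∑ i ∈ Finset.Icc 1 s, ∑ k ∈ Finset.range (n + 1), r i k / (t + (k : ℚ)) ^ i)
    (i : ℕ) (hi : i ∈ Finset.Icc 1 s) (k : ℕ) (hk : k ∈ Finset.range (n + 1)) :
    |r i k| ≤ A * 2 ^ ((s - Z.card + 2) * n) * (2 * N : ℚ) ^ (3 * s) * (n : ℚ) ^ (2 * s) := by
  have hkn : k ≤ n := by have := Finset.mem_range.1 hk; omega
  have hNq : (1 : ℚ) ≤ N := by exact_mod_cast hN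
  set e : ℚ := 1 / (2 * N : ℚ) with hedef
  have he0 : 0 < e := by positivity
  have he2 : e ≤ 1 / 2 := by
    rw [hedef]; exact one_div_le_one_div_of_le (by norm_num) (by linarith)
  set K : ℚ := A * ((Nat.factorial n : ℚ) ^ (s - Z.card + 1) / (Nat.factorial M : ℚ)) with hK
  have hK0 : 0 ≤ K := by positivity
  let Num : ℚ[X] := (C K * ∏ j ∈ Finset.range M, (X + C (θm + (j : ℚ) - k))) *
    ∏ θ ∈ Z.erase θm, ∏ j ∈ Finset.range n, (X + C (θ + (j : ℚ) - k))
  obtain ⟨W, hW⟩ := pf_identity (Finset.range (n + 1)) k hk (fun j => (j : ℚ) - k) (by simp) s Num r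
    (by
      intro x hx
      have h1 := hr (x - k) (fun j hj => by
        have := hx j hj
        rwa [show x - k + (j : ℚ) = x + (j - k) by ring])
      have e1 : ∀ j : ℕ, x - k + (j : ℚ) = x + (j - k) := fun j => by ring
      have e2 : ∀ (θ : ℚ) (j : ℕ), x - k + θ + (j : ℚ) = x + (θ + j - k) := fun θ j => by ring
      simp only [e1, e2] at h1
      rw [← h1]
      simp only [Num, eval_mul, eval_prod, eval_add, eval_X, eval_C])
  set P : ℚ[X] := ∑ i ∈ Finset.Icc 1 s, C (r i k) * X ^ (s - i) with hP
  have hi' := Finset.mem_Icc.1 hi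
  -- lower bound
  have hL1 : |r i k| * e ^ (s - i) ≤ wnorm e s P := by
    have := coeff_le_wnorm e he0.le s (s - i) (by omega) P
    rwa [hP, coeff_P s (fun i => r i k) i hi] at this
  have hDnn : ∀ j ∈ (Finset.range (n + 1)).erase k, 0 ≤ |(j : ℚ) - k| - e := by
    intro j hj
    have hne := (Finset.mem_erase.1 hj).1
    have h1 : (1 : ℚ) ≤ |(j : ℚ) - k| := by
      have : (1 : ℤ) ≤ |(j : ℤ) - k| := Int.one_le_abs (by omega)
      exact_mod_cast this
    linarith
  have hL2 := wnorm_prod_pow_lower e he0.le s P _ (fun j : ℕ => (j : ℚ) - k) hDnn s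
  set D : ℚ := ∏ j ∈ (Finset.range (n + 1)).erase k, (|(j : ℚ) - k| - e) with hD
  have hD0 : 0 ≤ D := Finset.prod_nonneg hDnn
  have hL3 : wnorm e s Num = wnorm e s (P * (∏ j ∈ (Finset.range (n + 1)).erase k,
      (X + C ((j : ℚ) - k))) ^ s) := by
    rw [hW, wnorm_congr]
  -- upper bound
  have hU1 := wnorm_prod_prod_upper e he0.le s
    (C K * ∏ j ∈ Finset.range M, (X + C (θm + (j : ℚ) - k))) (Z.erase θm) (Finset.range n)
    (fun θ (j : ℕ) => θ + (j : ℚ) - k) (fun j => (uu k j : ℚ))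
    (fun θ hθ' j _ => uu_bound e θ (hθ θ (Finset.mem_of_mem_erase hθ')).1
      (hθ θ (Finset.mem_of_mem_erase hθ')).2 k j) (fun j _ => by positivity)
  have hU2 := wnorm_prod_upper e he0.le s (C K) (Finset.range M)
    (fun j : ℕ => θm + (j : ℚ) - k) (fun j => (uu k j : ℚ))
    (fun j _ => uu_bound e θm (hθ θm hθm).1 (hθ θm hθm).2 k j)
  have hU3 : wnorm e s (C K) = K := by
    have : wnorm e s (C K) = K * wnorm e s 1 := by
      rw [← one_mul (C K), wnorm_mul_C, abs_of_nonneg hK0]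
    rw [this]
    have : wnorm e s 1 = 1 := by
      unfold wnorm
      rw [Finset.sum_eq_single 0]
      · simp
      · intro b _ hb; simp [coeff_one, hb]
      · intro h; exact absurd (Finset.mem_range.2 (by omega)) h
    rw [this, mul_one]
  obtain ⟨a, rfl⟩ := Nat.exists_eq_add_of_le hkn
  have hu4 : ∏ j ∈ Finset.range (k + a), (uu k j : ℚ) = k.factorial * a.factorial := by
    exact_mod_cast prod_uu_ge k a
  have hu5 : ∏ j ∈ Finset.range M, (uu k j : ℚ) ≤ M.factorial * 2 ^ (k + a) := by
    exact_mod_cast prod_uu_bound k M (k + a) hkn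
  have hcard : (Z.erase θm).card = Z.card - 1 := Finset.card_erase_of_mem hθm
  have hZpos : 1 ≤ Z.card := Finset.card_pos.2 ⟨_, hθm⟩
  rw [hu4, hcard] at hU1
  rw [hU3] at hU2
  have hden := den_bound e he2 k a hn
  rw [← hD] at hden
  set f : ℚ := (k.factorial : ℚ) * a.factorial with hf
  have hf0 : 0 < f := by positivity
  have hfac : ((k + a).factorial : ℚ) = ((k + a).choose k : ℚ) * f := by
    have := Nat.choose_mul_factorial_mul_factorial hkn
    rw [Nat.add_sub_cancel_left] at this
    rw [hf, ← mul_assoc]; exact_mod_cast this.symm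
  have hch : ((k + a).choose k : ℚ) ≤ 2 ^ (k + a) := by
    exact_mod_cast Nat.choose_le_two_pow (k + a) k
  set n : ℕ := k + a with hndef
  set b : ℚ := (n.choose k : ℚ)
  have hb0 : 0 ≤ b := by positivity
  have hM0 : (0 : ℚ) < M.factorial := by positivity
  have hn0 : (1 : ℚ) ≤ n := by exact_mod_cast hn
  -- combine
  have hup : wnorm e s Num ≤ A * 2 ^ ((s - Z.card + 2) * n) * f ^ s := by
    calc wnorm e s Num ≤ f ^ (Z.card - 1) * (((M.factorial : ℚ) * 2 ^ n) * K) :=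
          hU1.trans (mul_le_mul_of_nonneg_left
            (hU2.trans (mul_le_mul_of_nonneg_right hu5 hK0)) (by positivity))
      _ = A * (b ^ (s - Z.card + 1) * 2 ^ n) * f ^ s := by
          have : f ^ s = f ^ (Z.card - 1) * f ^ (s - Z.card + 1) := by
            rw [← pow_add]; congr 1; omega
          rw [this, hK, hfac]
          field_simp
          rw [mul_pow]
          ring
      _ ≤ A * ((2 ^ n) ^ (s - Z.card + 1) * 2 ^ n) * f ^ s := by gcongr
      _ = A * 2 ^ ((s - Z.card + 2) * n) * f ^ s := by
          rw [← pow_succ, ← pow_mul, mul_comm n]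
  have hlow : |r i k| * e ^ (s - i) * f ^ s
      ≤ A * 2 ^ ((s - Z.card + 2) * n) * (4 * (n : ℚ) ^ 2) ^ s * f ^ s := by
    calc |r i k| * e ^ (s - i) * f ^ s
        ≤ wnorm e s P * (4 * (n : ℚ) ^ 2 * D) ^ s := by
          have := wnorm_nonneg e he0.le s P
          gcongr
      _ = (4 * (n : ℚ) ^ 2) ^ s * (D ^ s * wnorm e s P) := by rw [mul_pow _ D]; ring
      _ ≤ (4 * (n : ℚ) ^ 2) ^ s * (A * 2 ^ ((s - Z.card + 2) * n) * f ^ s) := by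
          refine mul_le_mul_of_nonneg_left ?_ (by positivity)
          exact (hL2.trans hL3.ge).trans hup
      _ = _ := by ring
  have h6 := le_of_mul_le_mul_right hlow (by positivity)
  have h7 : e ^ (s - i) * (2 * N : ℚ) ^ (s - i) = 1 := by
    rw [← mul_pow, hedef, one_div, inv_mul_cancel₀ (by positivity), one_pow]
  calc |r i k| = |r i k| * e ^ (s - i) * (2 * N : ℚ) ^ (s - i) := by rw [mul_assoc, h7, mul_one]
    _ ≤ A * 2 ^ ((s - Z.card + 2) * n) * (4 * (n : ℚ) ^ 2) ^ s * (2 * N : ℚ) ^ (s - i) := by gcongr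
    _ ≤ A * 2 ^ ((s - Z.card + 2) * n) * ((2 * N : ℚ) ^ 2 * (n : ℚ) ^ 2) ^ s * (2 * N : ℚ) ^ s := by
        gcongr
        · nlinarith
        · linarith
        · omega
    _ = _ := by rw [mul_pow, ← pow_mul, ← pow_mul, show 3 * s = 2 * s + s by ring, pow_add]; ring

/-- Lemma 7.1: Archimedean bound
`|r_{i,k}| ≤ A₁(B)^n A₂(B)^n 2^{(s-|𝒵_B|+2)n} (2 p^{l_p} b_max)^{3s} n^{2s}`. -/
theorem partial_fraction_coeff_archimedean_bound
    (p : ℕ) [Fact p.Prime] (B : ℝ) (Ψ : Finset ℕ)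
    (hΨ : ∀ b : ℕ, b ∈ Ψ ↔ 1 ≤ b ∧ ((p ^ ellp p * b).totient : ℝ) ≤ B)
    (bmax : ℕ) (hbmem : bmax ∈ Ψ) (hbmax : ∀ b ∈ Ψ, b ≤ bmax)
    (Z : Finset ℚ)
    (hZ : ∀ x : ℚ, x ∈ Z ↔ ∃ a b : ℕ, b ∈ Ψ ∧ 1 ≤ a ∧ a ≤ p ^ ellp p * b ∧
      Nat.gcd a (p ^ ellp p * b) = 1 ∧ x = (a : ℚ) / ((p ^ ellp p * b : ℕ) : ℚ))
    (s : ℕ) (hsodd : Odd s) (hscard : Z.card + 1 < s)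
    (n : ℕ) (hnprime : (n + 1).Prime)
    (hndvd : ((Ψ.biUnion fun b => (p ^ ellp p * b).primeFactors).lcm (fun q => q - 1)) *
      p ^ ellp p * bmax ∣ n)
    (hdeg : (2 : ℤ) ≤ ((n : ℤ) + 1) * s - n * ((Z.card : ℤ) - 1) -
      (((p ^ ellp p * bmax - 1) * n / (p ^ ellp p * bmax) : ℕ) : ℤ) + 1)
    (r : ℕ → ℕ → ℚ)
    (hr : ∀ t : ℚ, (∀ j ∈ Finset.range (n + 1), t + (j : ℚ) ≠ 0) →
      Rfun p Ψ Z bmax s n t =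
        ∑ i ∈ Finset.Icc 1 s, ∑ k ∈ Finset.range (n + 1), r i k / (t + (k : ℚ)) ^ i) :
    ∀ i ∈ Finset.Icc 1 s, ∀ k ∈ Finset.range (n + 1),
      |r i k| ≤
        ((∏ b ∈ Ψ, (p ^ ellp p * b) ^ (p ^ ellp p * b).totient : ℕ) : ℚ) ^ n *
        ((∏ b ∈ Ψ, ∏ q ∈ (p ^ ellp p * b).primeFactors,
            q ^ ((p ^ ellp p * b).totient / (q - 1)) : ℕ) : ℚ) ^ n *
        2 ^ ((s - Z.card + 2) * n) *
        ((2 * p ^ ellp p * bmax : ℕ) : ℚ) ^ (3 * s) * (n : ℚ) ^ (2 * s) := by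
  have hp : p.Prime := Fact.out
  have hn : 1 ≤ n := by
    rcases Nat.eq_zero_or_pos n with h | h
    · subst h; exact absurd hnprime (by norm_num)
    · exact h
  have hq2 : 2 ≤ p ^ ellp p := by
    have h1 : ellp p ≠ 0 := by unfold ellp; split_ifs <;> norm_num
    exact hp.two_le.trans (Nat.le_self_pow h1 p)
  have hb1 : 1 ≤ bmax := ((hΨ bmax).1 hbmem).1
  set q : ℕ := p ^ ellp p with hqdef
  have hN2 : 2 ≤ q * bmax := by nlinarith
  have hNq : (2 : ℚ) ≤ ((q * bmax : ℕ) : ℚ) := by exact_mod_cast hN2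
  have hθm : (((q * bmax : ℕ) : ℚ) - 1) / ((q * bmax : ℕ) : ℚ) ∈ Z := by
    rw [hZ]
    refine ⟨q * bmax - 1, bmax, hbmem, by omega, by omega, ?_, ?_⟩
    · have : Nat.Coprime (q * bmax - 1) (q * bmax - 1 + 1) := by simp
      rwa [Nat.sub_add_cancel (by omega)] at this
    · rw [Nat.cast_sub (by omega)]; simp
  have hθ : ∀ θ ∈ Z, 1 / (2 * ((q * bmax : ℕ) : ℚ)) ≤ θ ∧
      θ ≤ 1 - 1 / (2 * ((q * bmax : ℕ) : ℚ)) := by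
    intro θ hθ
    obtain ⟨a, b, hb, ha1, ha2, hg, rfl⟩ := (hZ θ).1 hθ
    have hb1' : 1 ≤ b := ((hΨ b).1 hb).1
    have hbb := hbmax b hb
    have hd : q * b ≤ q * bmax := Nat.mul_le_mul_left _ hbb
    have hd2 : 2 ≤ q * b := by nlinarith
    have hlt : a < q * b := by
      rcases Nat.lt_or_ge a (q * b) with h | h
      · exact h
      · have : a = q * b := le_antisymm ha2 h
        rw [this, Nat.gcd_self] at hg
        omega
    generalize q * b = d at *
    generalize q * bmax = N at *
    have hdq : (0 : ℚ) < d := by exact_mod_cast (by omega : 0 < d)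
    have hdN : (d : ℚ) ≤ N := by exact_mod_cast hd
    have ha1q : (1 : ℚ) ≤ a := by exact_mod_cast ha1
    have hltq : (a : ℚ) + 1 ≤ d := by exact_mod_cast hlt
    have h1 : 1 / (2 * (N : ℚ)) ≤ 1 / (d : ℚ) := one_div_le_one_div_of_le hdq (by linarith)
    have h2 : 1 / (d : ℚ) ≤ a / d := by gcongr
    have h3 : (a : ℚ) / d + 1 / d ≤ 1 := by rw [← add_div, div_le_one hdq]; exact hltq
    constructor <;> linarith
  intro i hi k hk
  have := core_bound
    (((∏ b ∈ Ψ, (q * b) ^ (q * b).totient : ℕ) : ℚ) ^ n *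
      ((∏ b ∈ Ψ, ∏ x ∈ (q * b).primeFactors, x ^ ((q * b).totient / (x - 1)) : ℕ) : ℚ) ^ n)
    (by positivity) Z _ hθm (q * bmax) (by omega) hθ s n
    ((q * bmax - 1) * n / (q * bmax) - 1) hscard hn r
    (fun t ht => by rw [← hr t ht]; rfl) i hi k hk
  rw [show ((2 * q * bmax : ℕ) : ℚ) = 2 * ((q * bmax : ℕ) : ℚ) by push_cast; ring]
  exact this
end

section
/- Fix a prime p and set l_p = 1 if p ≥ 5, l_p = 2 if p = 3, l_p = 3 if p = 2; for real B > 0 let Ψ_B = { b ∈ ℤ_{≥1} : φ(p^{l_p} b) ≤ B }, A_1(B) = ∏_{b ∈ Ψ_B} (p^{l_p} b)^{φ(p^{l_p} b)} and A_2(B) = ∏_{b ∈ Ψ_B} ∏_{q prime, q | p^{l_p} b} q^{φ(p^{l_p} b)/(q−1)}, and let a_p = (ζ(2)ζ(3)/ζ(6)) · 1/(p^{l_p−2}(p² − p + 1)). Then: (a) log A_1(B) = (a_p/2 + o(1)) · B² log B as B → +∞, i.e. log A_1(B) / (B² log B) → a_p/2; and (b) there is a constant B_0 (depending only on p) such that for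 all B ≥ B_0 one has log A_2(B) ≤ 10 · B² · (log log B)². -/
open Filter

/-- The value `ζ(s) = ∑_{n≥1} 1/n^s` of the Riemann zeta function at a
natural number `s`, as a real number. -/
noncomputable def zetaR (s : ℕ) : ℝ := ∑' n : ℕ, 1 / ((n : ℝ) + 1) ^ s

/-- The constant `a_p = (ζ(2)ζ(3)/ζ(6)) · 1/(p^{l_p-2}(p²-p+1))`. -/
noncomputable def ap (p : ℕ) : ℝ :=
  (zetaR 2 * zetaR 3 / zetaR 6) *
    (1 / ((p : ℝ) ^ ((ellp p : ℤ) - 2) * ((p : ℝ) ^ 2 - (p : ℝ) + 1)))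


noncomputable def ffn (n : ℕ) : ℝ := ∏ q ∈ n.primeFactors, ((q : ℝ) / ((q : ℝ) - 1))

noncomputable def sgn (n : ℕ) : ℝ := ∑ d ∈ n.divisors, (1 : ℝ) / d

lemma two_le_of_mem_pf {n q : ℕ} (h : q ∈ n.primeFactors) : (2 : ℝ) ≤ q := by
  exact_mod_cast (Nat.prime_of_mem_primeFactors h).two_le

lemma totient_mul_ffn (n : ℕ) : (n.totient : ℝ) * ffn n = n := by
  have h : (n.totient : ℝ) = n * ∏ q ∈ n.primeFactors, (1 - (q : ℝ)⁻¹) := by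
    have := Nat.totient_eq_mul_prod_factors n
    have h2 : ((n.totient : ℚ) : ℝ) = ((n * ∏ p ∈ n.primeFactors, (1 - (p : ℚ)⁻¹) : ℚ) : ℝ) := by
      rw [this]
    push_cast at h2
    exact h2
  rw [h, ffn, mul_assoc, ← Finset.prod_mul_distrib, Finset.prod_eq_one, mul_one]
  intro q hq
  have := two_le_of_mem_pf hq
  have h1 : (q : ℝ) - 1 ≠ 0 := by linarith
  have h2 : (q : ℝ) ≠ 0 := by linarith
  field_simp

lemma ffn_pos (n : ℕ) : 0 < ffn n := by
  apply Finset.prod_pos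
  intro q hq
  have := two_le_of_mem_pf hq
  apply div_pos <;> linarith

lemma prod_Icc_sq (N : ℕ) : ∏ m ∈ Finset.Icc 2 (N + 1), ((m : ℝ) ^ 2 / ((m : ℝ) ^ 2 - 1)) = 2 * ((N : ℝ) + 1) / ((N : ℝ) + 2) := by
  induction N with
  | zero => norm_num
  | succ k ih =>
    rw [Finset.prod_Icc_succ_top (by omega), ih]
    push_cast
    have : ((k : ℝ) + 1 + 1) ^ 2 - 1 ≠ 0 := by
      have : (0 : ℝ) ≤ k := by positivity
      nlinarith
    field_simp
    ring

lemma prod_sq_le (S : Finset ℕ) (hS : ∀ q ∈ S, 2 ≤ q) :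
    ∏ m ∈ S, ((m : ℝ) ^ 2 / ((m : ℝ) ^ 2 - 1)) ≤ 2 := by
  have hsub : S ⊆ Finset.Icc 2 (S.sup id + 1) := by
    intro q hq
    rw [Finset.mem_Icc]
    have : id q ≤ S.sup id := Finset.le_sup hq
    exact ⟨hS q hq, by simp at this; omega⟩
  have h1 : ∀ m ∈ Finset.Icc 2 (S.sup id + 1), (1 : ℝ) ≤ (m : ℝ) ^ 2 / ((m : ℝ) ^ 2 - 1) := by
    intro m hm
    have : (2 : ℝ) ≤ m := by exact_mod_cast (Finset.mem_Icc.1 hm).1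
    rw [le_div_iff₀ (by nlinarith)]
    linarith
  calc _ ≤ ∏ m ∈ Finset.Icc 2 (S.sup id + 1), ((m : ℝ) ^ 2 / ((m : ℝ) ^ 2 - 1)) := by
        apply Finset.prod_le_prod_of_subset_of_one_le hsub
        · intro i hi
          linarith [h1 i (hsub hi)]
        · intro i hi _
          exact h1 i hi
    _ ≤ 2 := by
        rw [prod_Icc_sq, div_le_iff₀ (by positivity)]
        linarith

lemma prod_le_sgn (n : ℕ) (hn : n ≠ 0) : ∏ q ∈ n.primeFactors, (1 + 1 / (q : ℝ)) ≤ sgn n := by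
  rw [Finset.prod_one_add]
  have hinj : Set.InjOn (fun t : Finset ℕ => ∏ q ∈ t, q) (n.primeFactors.powerset : Set (Finset ℕ)) := by
    intro s hs t ht h
    simp only [Finset.coe_powerset, Set.mem_preimage, Set.mem_powerset_iff, Finset.coe_subset] at hs ht
    have h1 := Nat.primeFactors_prod (s := s) (fun q hq => Nat.prime_of_mem_primeFactors (hs hq))
    have h2 := Nat.primeFactors_prod (s := t) (fun q hq => Nat.prime_of_mem_primeFactors (ht hq))
    rw [← h1, ← h2]
    exact congrArg _ h
  have : ∑ t ∈ n.primeFactors.powerset, ∏ i ∈ t, (1 / (i : ℝ))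
      = ∑ d ∈ n.primeFactors.powerset.image (fun t : Finset ℕ => ∏ q ∈ t, q), (1 : ℝ) / d := by
    rw [Finset.sum_image hinj]
    apply Finset.sum_congr rfl
    intro t _
    simp
  rw [this]
  apply Finset.sum_le_sum_of_subset_of_nonneg
  · intro d hd
    obtain ⟨t, ht, rfl⟩ := Finset.mem_image.1 hd
    rw [Nat.mem_divisors]
    refine ⟨?_, hn⟩
    exact (Finset.prod_dvd_prod_of_subset _ _ _ (Finset.mem_powerset.1 ht)).trans (Nat.prod_primeFactors_dvd n)
  · intros; positivity

lemma ffn_le_sgn (n : ℕ) (hn : n ≠ 0) : ffn n ≤ 2 * sgn n := by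
  have h : ffn n = (∏ m ∈ n.primeFactors, ((m : ℝ) ^ 2 / ((m : ℝ) ^ 2 - 1))) *
      ∏ q ∈ n.primeFactors, (1 + 1 / (q : ℝ)) := by
    rw [ffn, ← Finset.prod_mul_distrib]
    apply Finset.prod_congr rfl
    intro q hq
    have := two_le_of_mem_pf hq
    have h1 : (q : ℝ) - 1 ≠ 0 := by linarith
    have h2 : (q : ℝ) ≠ 0 := by linarith
    have h3 : (q : ℝ) ^ 2 - 1 ≠ 0 := by nlinarith
    field_simp
    ring
  rw [h]
  apply mul_le_mul (prod_sq_le _ (fun q hq => (Nat.prime_of_mem_primeFactors hq).two_le)) (prod_le_sgn n hn)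
  · apply Finset.prod_nonneg; intros; positivity
  · norm_num

lemma sgn_le_log (n : ℕ) : sgn n ≤ 1 + Real.log n := by
  refine le_trans ?_ (harmonic_le_one_add_log n)
  rw [harmonic_eq_sum_Icc]
  push_cast
  rw [sgn]
  simp only [one_div]
  apply Finset.sum_le_sum_of_subset_of_nonneg
  · intro d hd
    rw [Finset.mem_Icc]
    exact ⟨Nat.pos_of_mem_divisors hd, Nat.divisor_le hd⟩
  · intros; positivity

/-- sum of inverse squares of multiples of `L` above `Z`. -/
lemma sum_mult_sq (S : Finset ℕ) (Z : ℝ) (hZ : 0 < Z) (hS : ∀ n ∈ S, Z < n) (L : ℕ) (hL : 0 < L) :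
    ∑ n ∈ S with L ∣ n, (1 : ℝ) / (n : ℝ) ^ 2 ≤ 2 / (L * Z) := by
  have hLr : (0 : ℝ) < L := by exact_mod_cast hL
  set k := ⌊Z / L⌋₊ with hk
  set N := S.sup id + 1 with hN
  have hsub : (S.filter (L ∣ ·)) ⊆ (Finset.Ioo k N).image (L * ·) := by
    intro n hn
    obtain ⟨hn, m, rfl⟩ := Finset.mem_filter.1 hn
    refine Finset.mem_image.2 ⟨m, ?_, rfl⟩
    rw [Finset.mem_Ioo]
    constructor
    · rw [hk, Nat.floor_lt (by positivity), div_lt_iff₀ hLr]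
      have := hS _ hn
      push_cast at this
      linarith
    · have : id (L * m) ≤ S.sup id := Finset.le_sup hn
      simp only [id] at this
      nlinarith
  calc _ ≤ ∑ n ∈ (Finset.Ioo k N).image (L * ·), (1 : ℝ) / (n : ℝ) ^ 2 := by
        apply Finset.sum_le_sum_of_subset_of_nonneg hsub
        intros; positivity
    _ = (1 / (L : ℝ) ^ 2) * ∑ i ∈ Finset.Ioo k N, ((i : ℝ) ^ 2)⁻¹ := by
        rw [Finset.sum_image, Finset.mul_sum]
        · apply Finset.sum_congr rfl
          intro i _
          push_cast
          rw [mul_pow]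
          field_simp
        · intro a _ b _ h
          exact Nat.eq_of_mul_eq_mul_left hL h
    _ ≤ (1 / (L : ℝ) ^ 2) * (2 / (k + 1)) := by
        gcongr
        exact sum_Ioo_inv_sq_le k N
    _ ≤ (1 / (L : ℝ) ^ 2) * (2 / (Z / L)) := by
        gcongr
        exact (Nat.lt_floor_add_one _).le
    _ = _ := by
        field_simp

noncomputable def KK : ℝ := ∑' d : ℕ, (1 : ℝ) / (d : ℝ) ^ (3 / 2 : ℝ)

lemma KK_summable : Summable (fun d : ℕ => (1 : ℝ) / (d : ℝ) ^ (3 / 2 : ℝ)) :=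
  Real.summable_one_div_nat_rpow.2 (by norm_num)

lemma lcm_bound (d e : ℕ) (hd : 0 < d) (he : 0 < e) :
    (1 : ℝ) / (d * e * (Nat.lcm d e)) ≤ 1 / (d : ℝ) ^ (3 / 2 : ℝ) * (1 / (e : ℝ) ^ (3 / 2 : ℝ)) := by
  have hdr : (0 : ℝ) < d := by exact_mod_cast hd
  have her : (0 : ℝ) < e := by exact_mod_cast he
  have h1 : (d : ℝ) ≤ Nat.lcm d e := by
    exact_mod_cast Nat.le_of_dvd (Nat.lcm_pos hd he) (Nat.dvd_lcm_left d e)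
  have h2 : (e : ℝ) ≤ Nat.lcm d e := by
    exact_mod_cast Nat.le_of_dvd (Nat.lcm_pos hd he) (Nat.dvd_lcm_right d e)
  rw [← one_div_mul_one_div_rev, one_div_mul_one_div, one_div_mul_one_div]
  have key : ∀ x : ℝ, 0 < x → x ^ (3 / 2 : ℝ) = x * √x := by
    intro x hx
    rw [Real.sqrt_eq_rpow, ← Real.rpow_one_add' hx.le (by norm_num)]
    norm_num
  rw [key _ hdr, key _ her]
  have h3 : √(d : ℝ) * √(e : ℝ) ≤ Nat.lcm d e := by
    rw [← Real.sqrt_mul hdr.le]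
    apply Real.sqrt_le_iff.2 ⟨by positivity, by nlinarith⟩
  apply one_div_le_one_div_of_le (by positivity)
  calc _ = (d : ℝ) * e * (√(d : ℝ) * √(e : ℝ)) := by ring
    _ ≤ (d : ℝ) * e * Nat.lcm d e := by gcongr
    _ = _ := by ring

lemma sgn_tail (S : Finset ℕ) (Z : ℝ) (hZ : 0 < Z) (hS : ∀ n ∈ S, Z < n) :
    ∑ n ∈ S, (sgn n) ^ 2 / (n : ℝ) ^ 2 ≤ 2 * KK ^ 2 / Z := by
  set N := S.sup id with hN
  have hle : ∀ n ∈ S, n ≤ N := fun n hn => Finset.le_sup (f := id) hn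
  have hdiv : ∀ n ∈ S, n.divisors = (Finset.Icc 1 N).filter (· ∣ n) := by
    intro n hn
    have hn0 : 0 < n := by
      have := hS n hn
      have : (0 : ℝ) < n := by linarith
      exact_mod_cast this
    ext d
    simp only [Nat.mem_divisors, Finset.mem_filter, Finset.mem_Icc]
    constructor
    · rintro ⟨h, _⟩
      exact ⟨⟨Nat.pos_of_dvd_of_pos h hn0, (Nat.le_of_dvd hn0 h).trans (hle n hn)⟩, h⟩
    · rintro ⟨_, h⟩
      exact ⟨h, by omega⟩
  calc ∑ n ∈ S, (sgn n) ^ 2 / (n : ℝ) ^ 2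
      = ∑ n ∈ S, ∑ d ∈ Finset.Icc 1 N, ∑ e ∈ Finset.Icc 1 N,
        (1 / (d * e : ℝ)) * (if Nat.lcm d e ∣ n then 1 / (n : ℝ) ^ 2 else 0) := by
        apply Finset.sum_congr rfl
        intro n hn
        rw [sgn, hdiv n hn, Finset.sum_filter, sq, Finset.sum_mul_sum, Finset.sum_div]
        apply Finset.sum_congr rfl
        intro d _
        rw [Finset.sum_div]
        apply Finset.sum_congr rfl
        intro e _
        by_cases h1 : d ∣ n <;> by_cases h2 : e ∣ n <;> simp [h1, h2, Nat.lcm_dvd_iff]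
        ring
    _ = ∑ d ∈ Finset.Icc 1 N, ∑ e ∈ Finset.Icc 1 N,
        (1 / (d * e : ℝ)) * ∑ n ∈ S with Nat.lcm d e ∣ n, 1 / (n : ℝ) ^ 2 := by
        rw [Finset.sum_comm]
        apply Finset.sum_congr rfl
        intro d _
        rw [Finset.sum_comm]
        apply Finset.sum_congr rfl
        intro e _
        rw [Finset.sum_filter, Finset.mul_sum]
    _ ≤ ∑ d ∈ Finset.Icc 1 N, ∑ e ∈ Finset.Icc 1 N,
        (2 / Z) * (1 / (d : ℝ) ^ (3 / 2 : ℝ) * (1 / (e : ℝ) ^ (3 / 2 : ℝ))) := by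
        apply Finset.sum_le_sum
        intro d hd
        apply Finset.sum_le_sum
        intro e he
        have hd := (Finset.mem_Icc.1 hd).1
        have he := (Finset.mem_Icc.1 he).1
        calc _ ≤ (1 / (d * e : ℝ)) * (2 / (Nat.lcm d e * Z)) := by
              gcongr
              exact sum_mult_sq S Z hZ hS _ (Nat.lcm_pos hd he)
          _ = (2 / Z) * (1 / (d * e * (Nat.lcm d e))) := by
              have : (0 : ℝ) < Nat.lcm d e := by exact_mod_cast Nat.lcm_pos hd he
              have : (0 : ℝ) < d := by exact_mod_cast hd
              have : (0 : ℝ) < e := by exact_mod_cast he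
              field_simp
          _ ≤ _ := by
              gcongr
              exact lcm_bound d e hd he
    _ = (2 / Z) * (∑ d ∈ Finset.Icc 1 N, 1 / (d : ℝ) ^ (3 / 2 : ℝ)) ^ 2 := by
        rw [sq, Finset.sum_mul_sum, Finset.mul_sum]
        apply Finset.sum_congr rfl
        intro d _
        rw [Finset.mul_sum]
    _ ≤ (2 / Z) * KK ^ 2 := by
        gcongr
        exact KK_summable.sum_le_tsum _ (by intros; positivity)
    _ = _ := by ring

/-- tail count -/
lemma tail_count (S : Finset ℕ) (B T : ℝ) (hB : 0 < B) (hT : 0 < T)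
    (hS : ∀ n ∈ S, T * B < n ∧ (n.totient : ℝ) ≤ B) : (S.card : ℝ) ≤ (8 * KK ^ 2 / T) * B := by
  have h0 : ∀ n ∈ S, 0 < n := by
    intro n hn
    have : (0 : ℝ) < n := lt_trans (by positivity) (hS n hn).1
    exact_mod_cast this
  calc (S.card : ℝ) = ∑ n ∈ S, (1 : ℝ) := by simp
    _ ≤ ∑ n ∈ S, (4 * B ^ 2) * ((sgn n) ^ 2 / (n : ℝ) ^ 2) := by
        apply Finset.sum_le_sum
        intro n hn
        have hn0 : (0 : ℝ) < n := by exact_mod_cast h0 n hn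
        have h1 := totient_mul_ffn n
        have h2 := ffn_le_sgn n (h0 n hn).ne'
        have h3 := ffn_pos n
        have h4 : (n : ℝ) ≤ B * (2 * sgn n) := by
          rw [← h1]
          apply mul_le_mul (hS n hn).2 h2 h3.le hB.le
        rw [← mul_div_assoc, le_div_iff₀ (by positivity), one_mul]
        calc (n : ℝ) ^ 2 ≤ (B * (2 * sgn n)) ^ 2 := by gcongr
          _ = _ := by ring
    _ = (4 * B ^ 2) * ∑ n ∈ S, ((sgn n) ^ 2 / (n : ℝ) ^ 2) := by rw [Finset.mul_sum]
    _ ≤ (4 * B ^ 2) * (2 * KK ^ 2 / (T * B)) := by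
        gcongr
        exact sgn_tail S _ (by positivity) (fun n hn => (hS n hn).1)
    _ = _ := by field_simp; ring


noncomputable def Fy (P y b : ℕ) : ℝ :=
  ∏ q ∈ y.primesBelow, if q ∣ P * b then ((q : ℝ) / ((q : ℝ) - 1)) else 1

noncomputable def sy (P y b : ℕ) : ℝ :=
  ∑ q ∈ (P * b).primeFactors with ¬ q < y, 1 / ((q : ℝ) - 1)

lemma Fy_eq (P y b : ℕ) (h : P * b ≠ 0) :
    Fy P y b = ∏ q ∈ (P * b).primeFactors with q < y, ((q : ℝ) / ((q : ℝ) - 1)) := by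
  rw [Fy, ← Finset.prod_filter]
  apply Finset.prod_congr _ (fun _ _ => rfl)
  ext q
  simp only [Finset.mem_filter, Nat.mem_primesBelow, Nat.mem_primeFactors]
  tauto

lemma ffn_split (P y b : ℕ) (h : P * b ≠ 0) :
    ffn (P * b) = Fy P y b * ∏ q ∈ (P * b).primeFactors with ¬ q < y, ((q : ℝ) / ((q : ℝ) - 1)) := by
  rw [Fy_eq P y b h, ffn, Finset.prod_filter_mul_prod_filter_not]

lemma one_le_fac {q : ℕ} (h : (2 : ℝ) ≤ q) : (1 : ℝ) ≤ (q : ℝ) / ((q : ℝ) - 1) := by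
  rw [le_div_iff₀ (by linarith)]; linarith

lemma Fy_pos (P y b : ℕ) : 0 < Fy P y b := by
  apply Finset.prod_pos
  intro q hq
  have h2 : (2 : ℝ) ≤ q := by exact_mod_cast (Nat.prime_of_mem_primesBelow hq).two_le
  have := one_le_fac h2
  split_ifs <;> linarith

lemma Fy_le (P y b : ℕ) (h : P * b ≠ 0) : Fy P y b ≤ ffn (P * b) := by
  rw [ffn_split P y b h]
  apply le_mul_of_one_le_right (Fy_pos _ _ _).le
  refine (Finset.prod_const_one (s := (P * b).primeFactors.filter (fun q => ¬ q < y))).symm.le.trans ?_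
  apply Finset.prod_le_prod
  · intros; exact zero_le_one
  · intro q hq
    exact one_le_fac (two_le_of_mem_pf (Finset.mem_filter.1 hq).1)

lemma ffn_le_Fy (P y b : ℕ) (h : P * b ≠ 0) : ffn (P * b) ≤ Fy P y b * Real.exp (sy P y b) := by
  rw [ffn_split P y b h]
  apply mul_le_mul_of_nonneg_left _ (Fy_pos _ _ _).le
  rw [sy, Real.exp_sum]
  apply Finset.prod_le_prod
  · intro q hq
    linarith [one_le_fac (two_le_of_mem_pf (Finset.mem_filter.1 hq).1)]
  · intro q hq
    have h2 := two_le_of_mem_pf (Finset.mem_filter.1 hq).1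
    have := Real.add_one_le_exp (1 / ((q : ℝ) - 1))
    refine le_trans (le_of_eq ?_) this
    have : (q : ℝ) - 1 ≠ 0 := by linarith
    field_simp
    ring

/-- few integers have a large contribution from large primes. -/
lemma sy_count (P p l y : ℕ) (hp : p.Prime) (hP : P = p ^ l) (hy : p < y) (W δ : ℝ) (hW : 0 ≤ W) (hδ : 0 < δ)
    (S : Finset ℕ) (hS : ∀ b ∈ S, 0 < b ∧ (b : ℝ) ≤ W ∧ δ ≤ sy P y b) :
    (S.card : ℝ) ≤ 2 * W / (δ * (y - 1)) := by
  have hy2 : 3 ≤ y := by have := hp.two_le; omega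
  have hyr : (3 : ℝ) ≤ y := by exact_mod_cast hy2
  set N := ⌊W⌋₊ with hN
  have hSN : ∀ b ∈ S, b ≤ N := fun b hb => Nat.le_floor (hS b hb).2.1
  have hsy : ∀ b ∈ S, sy P y b ≤ ∑ q ∈ Finset.Ioo (y - 1) (N + 1), if q ∣ b then 1 / ((q : ℝ) - 1) else 0 := by
    intro b hb
    have hb0 := (hS b hb).1
    rw [← Finset.sum_filter, sy]
    apply Finset.sum_le_sum_of_subset_of_nonneg
    · intro q hq
      simp only [Finset.mem_filter, Nat.mem_primeFactors, Finset.mem_Ioo] at hq ⊢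
      obtain ⟨⟨hq1, hq2, -⟩, hq3⟩ := hq
      have hqb : q ∣ b := by
        rcases hq1.dvd_mul.1 hq2 with h | h
        · rw [hP] at h
          have := (Nat.prime_dvd_prime_iff_eq hq1 hp).1 (hq1.dvd_of_dvd_pow h)
          omega
        · exact h
      have := Nat.le_of_dvd hb0 hqb
      have := hSN b hb
      exact ⟨⟨by omega, by omega⟩, hqb⟩
    · intro q hq _
      have := (Finset.mem_Ioo.1 (Finset.mem_filter.1 hq).1).1
      have : (3 : ℝ) ≤ q := by exact_mod_cast (by omega : 3 ≤ q)
      apply div_nonneg <;> linarith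
  have hmain : δ * S.card ≤ W * (2 / (y - 1)) := by
    calc δ * S.card = ∑ b ∈ S, δ := by simp [mul_comm]
      _ ≤ ∑ b ∈ S, ∑ q ∈ Finset.Ioo (y - 1) (N + 1), if q ∣ b then 1 / ((q : ℝ) - 1) else 0 :=
        Finset.sum_le_sum (fun b hb => (hS b hb).2.2.trans (hsy b hb))
      _ ≤ ∑ b ∈ Finset.Ioc 0 N, ∑ q ∈ Finset.Ioo (y - 1) (N + 1), if q ∣ b then 1 / ((q : ℝ) - 1) else 0 := by
        apply Finset.sum_le_sum_of_subset_of_nonneg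
        · intro b hb
          rw [Finset.mem_Ioc]; exact ⟨(hS b hb).1, hSN b hb⟩
        · intro b _ _
          apply Finset.sum_nonneg
          intro q hq
          have := (Finset.mem_Ioo.1 hq).1
          have : (3 : ℝ) ≤ q := by exact_mod_cast (by omega : 3 ≤ q)
          split_ifs
          · apply div_nonneg <;> linarith
          · exact le_rfl
      _ = ∑ q ∈ Finset.Ioo (y - 1) (N + 1), ((N / q : ℕ) : ℝ) * (1 / ((q : ℝ) - 1)) := by
        rw [Finset.sum_comm]
        apply Finset.sum_congr rfl
        intro q _
        rw [← Finset.sum_filter, Finset.sum_const, Nat.Ioc_filter_dvd_card_eq_div, nsmul_eq_mul]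
      _ ≤ ∑ q ∈ Finset.Ioo (y - 1) (N + 1), W * (((q - 1 : ℕ) : ℝ) ^ 2)⁻¹ := by
        apply Finset.sum_le_sum
        intro q hq
        have := (Finset.mem_Ioo.1 hq).1
        have hq3 : (3 : ℝ) ≤ q := by exact_mod_cast (by omega : 3 ≤ q)
        rw [Nat.cast_sub (by omega)]
        push_cast
        have h1 : ((N / q : ℕ) : ℝ) ≤ W / (q - 1) := by
          calc ((N / q : ℕ) : ℝ) ≤ (N : ℝ) / q := Nat.cast_div_le
            _ ≤ W / q := by
              gcongr
              exact Nat.floor_le hW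
            _ ≤ W / (q - 1) := by
              apply div_le_div_of_nonneg_left hW <;> linarith
        have h2 : (0 : ℝ) < q - 1 := by linarith
        calc _ ≤ W / (q - 1) * (1 / ((q : ℝ) - 1)) := by gcongr
          _ = _ := by field_simp
      _ = W * ∑ i ∈ Finset.Ioo (y - 2) N, ((i : ℝ) ^ 2)⁻¹ := by
        rw [← Finset.mul_sum]
        congr 1
        apply Finset.sum_bij' (fun q _ => q - 1) (fun i _ => i + 1)
        all_goals simp only [Finset.mem_Ioo]
        all_goals (intros; first | trivial | omega)
      _ ≤ W * (2 / ((y - 2 : ℕ) + 1)) := by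
        gcongr
        exact sum_Ioo_inv_sq_le _ _
      _ = _ := by
        rw [Nat.cast_sub (by omega)]
        push_cast
        congr 2
        ring
  have : (0 : ℝ) < y - 1 := by linarith
  rw [le_div_iff₀ (by positivity)]
  have h3 : W * (2 / ((y : ℝ) - 1)) * (y - 1) = 2 * W := by field_simp
  have h4 := mul_le_mul_of_nonneg_right hmain this.le
  linarith

def My (y : ℕ) : ℕ := ∏ q ∈ y.primesBelow, q

lemma My_pos (y : ℕ) : 0 < My y :=
  Finset.prod_pos (fun _ hq => (Nat.prime_of_mem_primesBelow hq).pos)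

lemma Fy_mod (P y b c : ℕ) (h : b ≡ c [MOD My y]) : Fy P y b = Fy P y c := by
  apply Finset.prod_congr rfl
  intro q hq
  have hd : q ∣ My y := Finset.dvd_prod_of_mem _ hq
  have : q ∣ P * b ↔ q ∣ P * c := ((h.mul_left P).of_dvd hd).dvd_iff dvd_rfl
  simp only [this]

noncomputable def Ey (P y : ℕ) (B : ℝ) : Finset ℕ :=
  (Finset.range (My y)).biUnion fun r =>
    (Finset.Ioc 0 ⌊B * Fy P y r / P⌋₊).filter (· ≡ r [MOD My y])

lemma mem_Ey (P y : ℕ) (hP : 0 < P) (B : ℝ) (hB : 0 ≤ B) (b : ℕ) :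
    b ∈ Ey P y B ↔ 0 < b ∧ ((P * b : ℕ) : ℝ) ≤ B * Fy P y b := by
  have hPr : (0 : ℝ) < P := by exact_mod_cast hP
  have key : ∀ r, (b ≤ ⌊B * Fy P y r / P⌋₊ ↔ ((P * b : ℕ) : ℝ) ≤ B * Fy P y r) := by
    intro r
    have := Fy_pos P y r
    rw [Nat.le_floor_iff (by positivity), le_div_iff₀ hPr]
    push_cast
    rw [mul_comm]
  simp only [Ey, Finset.mem_biUnion, Finset.mem_range, Finset.mem_filter, Finset.mem_Ioc, key]
  constructor
  · rintro ⟨r, _, ⟨h1, h2⟩, h3⟩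
    rw [Fy_mod P y b r h3]
    exact ⟨h1, h2⟩
  · rintro ⟨h1, h2⟩
    refine ⟨b % My y, Nat.mod_lt _ (My_pos y), ⟨h1, ?_⟩, (Nat.mod_modEq _ _).symm⟩
    rw [Fy_mod P y _ b (Nat.mod_modEq _ _)]
    exact h2

lemma card_Ey (P y : ℕ) (B : ℝ) : ((Ey P y B).card : ℝ) =
    ∑ r ∈ Finset.range (My y), (((Finset.Ioc 0 ⌊B * Fy P y r / P⌋₊).filter (· ≡ r [MOD My y])).card : ℝ) := by
  rw [Ey, Finset.card_biUnion]
  · push_cast; rfl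
  · intro r hr s hs hrs
    rw [Function.onFun, Finset.disjoint_left]
    intro b hb hb'
    have h1 := (Finset.mem_filter.1 hb).2
    have h2 := (Finset.mem_filter.1 hb').2
    exact hrs (Nat.ModEq.eq_of_lt_of_lt (h1.symm.trans h2) (Finset.mem_range.1 hr) (Finset.mem_range.1 hs))

lemma count_mod_tendsto (M r : ℕ) (hM : 0 < M) :
    Tendsto (fun n : ℕ => (((Finset.Ioc 0 n).filter (· ≡ r [MOD M])).card : ℝ) / n) atTop (nhds (1 / M)) := by
  have hMr : (0 : ℝ) < M := by exact_mod_cast hM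
  have hb : ∀ n : ℕ, |(((Finset.Ioc 0 n).filter (· ≡ r [MOD M])).card : ℝ) - n / M| ≤ 1 := by
    intro n
    have h := Nat.Ioc_filter_modEq_card 0 n hM r
    have hmono : (⌊((0 : ℕ) - (r : ℚ)) / M⌋ : ℤ) ≤ ⌊((n : ℚ) - r) / M⌋ := by
      apply Int.floor_mono
      have : (0 : ℚ) < M := by exact_mod_cast hM
      gcongr
      exact Nat.zero_le n
    rw [max_eq_left (by linarith)] at h
    have h' : (((Finset.Ioc 0 n).filter (· ≡ r [MOD M])).card : ℚ) =
      (⌊((n : ℚ) - r) / M⌋ : ℚ) - (⌊((0 : ℕ) - (r : ℚ)) / M⌋ : ℚ) := by exact_mod_cast h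
    have a1 := Int.floor_le (((n : ℚ) - r) / M)
    have a2 := Int.lt_floor_add_one (((n : ℚ) - r) / M)
    have a3 := Int.floor_le (((0 : ℕ) - (r : ℚ)) / M)
    have a4 := Int.lt_floor_add_one (((0 : ℕ) - (r : ℚ)) / M)
    have e : ((n : ℚ) - r) / M - ((0 : ℕ) - (r : ℚ)) / M = n / M := by
      push_cast; ring
    have : |(((Finset.Ioc 0 n).filter (· ≡ r [MOD M])).card : ℚ) - n / M| ≤ 1 := by
      rw [h', abs_le]; constructor <;> linarith
    have h2 := (Rat.cast_le (K := ℝ)).2 this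
    push_cast at h2
    exact h2
  have hz : Tendsto (fun n : ℕ => (1 : ℝ) / n) atTop (nhds 0) := tendsto_one_div_atTop_nhds_zero_nat
  rw [tendsto_iff_norm_sub_tendsto_zero]
  refine squeeze_zero' (Eventually.of_forall fun _ => norm_nonneg _) ?_ hz
  filter_upwards [eventually_gt_atTop 0] with n hn
  have hn' : (0 : ℝ) < n := by exact_mod_cast hn
  have : (((Finset.Ioc 0 n).filter (· ≡ r [MOD M])).card : ℝ) / n - 1 / M =
    ((((Finset.Ioc 0 n).filter (· ≡ r [MOD M])).card : ℝ) - n / M) / n := by field_simp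
  rw [this, norm_div, Real.norm_eq_abs, Real.norm_eq_abs, abs_of_pos hn']
  exact div_le_div_of_nonneg_right (hb n) hn'.le

lemma Ey_tendsto (P y : ℕ) (hP : 0 < P) :
    Tendsto (fun B : ℝ => ((Ey P y B).card : ℝ) / B) atTop
      (nhds (∑ r ∈ Finset.range (My y), (1 / (My y : ℝ)) * (Fy P y r / P))) := by
  simp only [card_Ey, Finset.sum_div]
  apply tendsto_finsetSum
  intro r _
  have hPr : (0 : ℝ) < P := by exact_mod_cast hP
  have hF := Fy_pos P y r
  set c := Fy P y r / P with hc
  have hc0 : 0 < c := by positivity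
  have h1 : Tendsto (fun B : ℝ => ⌊c * B⌋₊) atTop atTop :=
    tendsto_nat_floor_atTop.comp (tendsto_id.const_mul_atTop hc0)
  have h2 := (count_mod_tendsto (My y) r (My_pos y)).comp h1
  have h3 : Tendsto (fun B : ℝ => (⌊c * B⌋₊ : ℝ) / B) atTop (nhds c) :=
    tendsto_nat_floor_mul_div_atTop hc0.le
  refine (h2.mul h3).congr' ?_
  filter_upwards [h1.eventually_gt_atTop 0] with B hB
  have hne : (⌊c * B⌋₊ : ℝ) ≠ 0 := by exact_mod_cast hB.ne'
  have : B * Fy P y r / P = c * B := by rw [hc]; ring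
  rw [this]
  simp only [Function.comp]
  field_simp

/-- mean value of `Fy`. -/
lemma Fy_mean (P p l y : ℕ) (hp : p.Prime) (hl : l ≠ 0) (hP : P = p ^ l) :
    ∑ r ∈ Finset.range (My y), (1 / (My y : ℝ)) * (Fy P y r / P) =
    (1 / P) * ∏ q ∈ y.primesBelow, (if q = p then (q : ℝ) / (q - 1) else 1 + 1 / ((q : ℝ) * (q - 1))) := by
  have hM := My_pos y
  have hMr : (0 : ℝ) < My y := by exact_mod_cast hM
  let u : ℕ → ℝ := fun q => if q = p then (q : ℝ) / (q - 1) else 1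
  let v : ℕ → ℝ := fun q => if q = p then 0 else 1 / ((q : ℝ) - 1)
  have hF : ∀ r, Fy P y r = (∏ q ∈ y.primesBelow, u q) *
      ∑ t ∈ y.primesBelow.powerset, (∏ q ∈ t, v q) * (if (∏ q ∈ t, q) ∣ r then 1 else 0) := by
    intro r
    have h1 : Fy P y r = (∏ q ∈ y.primesBelow, u q) *
        ∏ q ∈ y.primesBelow, (1 + v q * (if q ∣ r then 1 else 0)) := by
      rw [← Finset.prod_mul_distrib, Fy]
      apply Finset.prod_congr rfl
      intro q hq
      have hqp := Nat.prime_of_mem_primesBelow hq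
      have h2 : (2 : ℝ) ≤ q := by exact_mod_cast hqp.two_le
      have h3 : (q : ℝ) - 1 ≠ 0 := by linarith
      by_cases hqe : q = p
      · have : q ∣ P * r := by
          rw [hP, hqe]; exact (dvd_pow_self p hl).mul_right _
        simp [u, v, hqe]
        intro h
        exact absurd (hqe ▸ this) h
      · have : q ∣ P * r ↔ q ∣ r := by
          constructor
          · intro h
            rcases hqp.dvd_mul.1 h with h | h
            · rw [hP] at h
              exact absurd ((Nat.prime_dvd_prime_iff_eq hqp hp).1 (hqp.dvd_of_dvd_pow h)) hqe
            · exact h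
          · exact fun h => h.mul_left _
        by_cases hr : q ∣ r
        · simp only [this, hr, if_true, u, v, hqe, if_false]
          field_simp
          ring
        · simp [this, hr, u, v, hqe]
    rw [h1, Finset.prod_one_add]
    congr 1
    apply Finset.sum_congr rfl
    intro t ht
    have hts := Finset.mem_powerset.1 ht
    rw [Finset.prod_mul_distrib]
    congr 1
    by_cases h : (∏ q ∈ t, q) ∣ r
    · rw [if_pos h]
      apply Finset.prod_eq_one
      intro q hq
      rw [if_pos ((Finset.dvd_prod_of_mem _ hq).trans h)]
    · rw [if_neg h]
      by_contra hne
      apply h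
      apply Finset.prod_primes_dvd
      · intro q hq
        exact (Nat.prime_of_mem_primesBelow (hts hq)).prime
      · intro q hq
        by_contra hqr
        exact hne (Finset.prod_eq_zero hq (by rw [if_neg hqr]))
  have hcount : ∀ t ∈ y.primesBelow.powerset, ∑ r ∈ Finset.range (My y), (if (∏ q ∈ t, q) ∣ r then (1 : ℝ) else 0)
      = My y * ∏ q ∈ t, (1 / (q : ℝ)) := by
    intro t ht
    have hts := Finset.mem_powerset.1 ht
    have hd : (∏ q ∈ t, q) ∣ My y := Finset.prod_dvd_prod_of_subset _ _ _ hts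
    set k := ∏ q ∈ t, q with hk
    have hk0 : 0 < k := Nat.pos_of_dvd_of_pos hd hM
    have hkr : (k : ℝ) ≠ 0 := by exact_mod_cast hk0.ne'
    rw [← Finset.sum_filter, Finset.sum_const, nsmul_eq_mul, mul_one]
    have hc : ((Finset.range (My y)).filter (k ∣ ·)).card = My y / k := by
      have h := Nat.count_modEq_card (My y) hk0 0
      rw [Nat.count_eq_card_filter_range] at h
      have e : My y % k = 0 := Nat.mod_eq_zero_of_dvd hd
      simp only [e, Nat.zero_mod, lt_irrefl, if_false, add_zero, Nat.modEq_zero_iff_dvd] at h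
      exact h
    rw [hc, Nat.cast_div hd hkr]
    have : ∏ q ∈ t, (1 / (q : ℝ)) = 1 / k := by
      rw [hk]; push_cast; simp
    rw [this]
    ring
  rw [← Finset.mul_sum, ← Finset.sum_div]
  simp only [hF]
  rw [← Finset.mul_sum, Finset.sum_comm]
  have : ∑ t ∈ y.primesBelow.powerset, ∑ r ∈ Finset.range (My y),
      (∏ q ∈ t, v q) * (if (∏ q ∈ t, q) ∣ r then (1 : ℝ) else 0) =
      My y * ∏ q ∈ y.primesBelow, (1 + v q * (1 / (q : ℝ))) := by
    rw [Finset.prod_one_add, Finset.mul_sum]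
    apply Finset.sum_congr rfl
    intro t ht
    rw [← Finset.mul_sum, hcount t ht, Finset.prod_mul_distrib]
    ring
  rw [this]
  have h5 : (∏ q ∈ y.primesBelow, u q) * ∏ q ∈ y.primesBelow, (1 + v q * (1 / (q : ℝ))) =
      ∏ q ∈ y.primesBelow, (if q = p then (q : ℝ) / (q - 1) else 1 + 1 / ((q : ℝ) * (q - 1))) := by
    rw [← Finset.prod_mul_distrib]
    apply Finset.prod_congr rfl
    intro q hq
    by_cases hqe : q = p
    · simp [u, v, hqe]
    · simp [u, v, hqe]
  rw [← h5]
  field_simp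

lemma zetaR_summable (s : ℕ) (hs : 2 ≤ s) : Summable (fun n : ℕ => 1 / (n : ℝ) ^ s) :=
  Real.summable_one_div_nat_pow.2 (by omega)

lemma zetaR_eq (s : ℕ) (hs : 2 ≤ s) : zetaR s = ∑' n : ℕ, 1 / (n : ℝ) ^ s := by
  rw [zetaR, (zetaR_summable s hs).tsum_eq_zero_add]
  have : s ≠ 0 := by omega
  simp [this]

noncomputable def powHom (s : ℕ) (hs : s ≠ 0) : ℕ →*₀ ℝ where
  toFun n := 1 / (n : ℝ) ^ s
  map_zero' := by simp [hs]
  map_one' := by simp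
  map_mul' a b := by push_cast; rw [mul_pow]; field_simp

lemma zetaR_euler (s : ℕ) (hs : 2 ≤ s) :
    Tendsto (fun n : ℕ => ∏ q ∈ n.primesBelow, (1 - 1 / (q : ℝ) ^ s)⁻¹) atTop (nhds (zetaR s)) := by
  rw [zetaR_eq s hs]
  have := EulerProduct.eulerProduct_completely_multiplicative (f := powHom s (by omega)) (by
    have := (zetaR_summable s hs).norm
    exact this)
  exact this

lemma zetaR_one_le (s : ℕ) (hs : 2 ≤ s) : 1 ≤ zetaR s := by
  rw [zetaR_eq s hs]
  have := (zetaR_summable s hs).le_tsum 1 (by intros; positivity)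
  simpa using this

lemma euler_const : Tendsto (fun n : ℕ => ∏ q ∈ n.primesBelow, (1 + 1 / ((q : ℝ) * (q - 1)))) atTop
    (nhds (zetaR 2 * zetaR 3 / zetaR 6)) := by
  have h := ((zetaR_euler 2 le_rfl).mul (zetaR_euler 3 (by norm_num))).div (zetaR_euler 6 (by norm_num))
    (by linarith [zetaR_one_le 6 (by norm_num)])
  refine h.congr ?_
  intro n
  simp only [Pi.div_apply]
  rw [← Finset.prod_mul_distrib, ← Finset.prod_div_distrib]
  apply Finset.prod_congr rfl
  intro q hq
  have h2 : (2 : ℝ) ≤ q := by exact_mod_cast (Nat.prime_of_mem_primesBelow hq).two_le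
  have e1 : (q : ℝ) - 1 ≠ 0 := by linarith
  have e0 : (q : ℝ) ≠ 0 := by linarith
  have e2 : (q : ℝ) + 1 ≠ 0 := by linarith
  have e3 : (q : ℝ) ^ 2 + q + 1 ≠ 0 := by nlinarith
  have e4 : (q : ℝ) ^ 2 - q + 1 ≠ 0 := by nlinarith
  have f2 : (1 : ℝ) - 1 / (q : ℝ) ^ 2 = (q - 1) * (q + 1) / (q : ℝ) ^ 2 := by field_simp; ring
  have f3 : (1 : ℝ) - 1 / (q : ℝ) ^ 3 = (q - 1) * (q ^ 2 + q + 1) / (q : ℝ) ^ 3 := by field_simp; ring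
  have f6 : (1 : ℝ) - 1 / (q : ℝ) ^ 6 =
    (q - 1) * (q ^ 2 + q + 1) * (q + 1) * (q ^ 2 - q + 1) / (q : ℝ) ^ 6 := by field_simp; ring
  rw [f2, f3, f6]
  field_simp

lemma mean_tendsto (P p : ℕ) (hp : p.Prime) (hP : P = p ^ ellp p) :
    Tendsto (fun y : ℕ => (1 / (P : ℝ)) * ∏ q ∈ y.primesBelow,
      (if q = p then (q : ℝ) / (q - 1) else 1 + 1 / ((q : ℝ) * (q - 1)))) atTop (nhds (ap p)) := by
  have h2 : (2 : ℝ) ≤ p := by exact_mod_cast hp.two_le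
  have e1 : (p : ℝ) - 1 ≠ 0 := by linarith
  have e0 : (p : ℝ) ≠ 0 := by linarith
  have e4 : (p : ℝ) ^ 2 - p + 1 ≠ 0 := by nlinarith
  have e6 : (p : ℝ) ^ 2 - p + 1 = p * (p - 1) + 1 := by ring
  have h := euler_const.const_mul ((1 / (P : ℝ)) * ((p : ℝ) ^ 2 / (p ^ 2 - p + 1)))
  have hap : (1 / (P : ℝ)) * ((p : ℝ) ^ 2 / (p ^ 2 - p + 1)) * (zetaR 2 * zetaR 3 / zetaR 6) = ap p := by
    rw [ap, hP, zpow_sub₀ e0]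
    push_cast
    have : (p : ℝ) ^ ((2 : ℤ)) = (p : ℝ) ^ 2 := by norm_cast
    rw [this, zpow_natCast]
    field_simp
  rw [hap] at h
  refine h.congr' ?_
  filter_upwards [eventually_gt_atTop p] with y hy
  have hm : p ∈ y.primesBelow := Nat.mem_primesBelow.2 ⟨hy, hp⟩
  rw [← Finset.mul_prod_erase _ _ hm, ← Finset.mul_prod_erase _ (fun q : ℕ => if q = p then (q : ℝ) / (q - 1) else 1 + 1 / ((q : ℝ) * (q - 1))) hm]
  rw [if_pos rfl]
  have : ∏ q ∈ y.primesBelow.erase p, (if q = p then (q : ℝ) / (q - 1) else 1 + 1 / ((q : ℝ) * (q - 1)))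
      = ∏ q ∈ y.primesBelow.erase p, (1 + 1 / ((q : ℝ) * (q - 1))) := by
    apply Finset.prod_congr rfl
    intro q hq
    rw [if_neg (Finset.ne_of_mem_erase hq)]
  rw [this]
  have : (1 : ℝ) + 1 / (p * (p - 1)) = (p * (p - 1) + 1) / (p * (p - 1)) := by field_simp
  rw [this]
  rw [e6]
  have e5 : (p : ℝ) * (p - 1) + 1 ≠ 0 := by nlinarith
  generalize ∏ q ∈ y.primesBelow.erase p, (1 + 1 / ((q : ℝ) * (q - 1))) = Q
  have hPr : (P : ℝ) ≠ 0 := by rw [hP]; push_cast; positivity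
  field_simp

lemma ellp_ne (p : ℕ) : ellp p ≠ 0 := by
  unfold ellp; split_ifs <;> norm_num

lemma Psi_lower (p : ℕ) (hp : p.Prime) (Ψ : ℝ → Finset ℕ)
    (hΨ : ∀ (B : ℝ) (b : ℕ), b ∈ Ψ B ↔ 1 ≤ b ∧ ((p ^ ellp p * b).totient : ℝ) ≤ B) (y : ℕ) (B : ℝ) (hB : 0 ≤ B) : Ey (p ^ ellp p) y B ⊆ Ψ B := by
  have hP : 0 < p ^ ellp p := pow_pos hp.pos _
  intro b hb
  rw [mem_Ey _ _ hP B hB] at hb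
  rw [hΨ]
  refine ⟨hb.1, ?_⟩
  have h0 : p ^ ellp p * b ≠ 0 := (Nat.mul_pos hP hb.1).ne'
  have h1 := totient_mul_ffn (p ^ ellp p * b)
  have h2 := ffn_pos (p ^ ellp p * b)
  have h3 := mul_le_mul_of_nonneg_left (Fy_le (p ^ ellp p) y b h0) hB
  have h4 := hb.2.trans h3
  rw [← h1] at h4
  exact le_of_mul_le_mul_right h4 h2

lemma Psi_upper (p : ℕ) (hp : p.Prime) (Ψ : ℝ → Finset ℕ)
    (hΨ : ∀ (B : ℝ) (b : ℕ), b ∈ Ψ B ↔ 1 ≤ b ∧ ((p ^ ellp p * b).totient : ℝ) ≤ B)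
    (y : ℕ) (hy : p < y) (B δ T : ℝ) (hB : 0 < B) (hδ : 0 < δ) (hT : 0 < T) :
    ((Ψ B).card : ℝ) ≤ (Ey (p ^ ellp p) y (Real.exp δ * B)).card + 2 * (T * B) / (δ * (y - 1))
      + 8 * KK ^ 2 / T * B := by
  have hP : 0 < p ^ ellp p := pow_pos hp.pos _
  set P := p ^ ellp p with hPd
  set S1 := (Ψ B).filter (fun b : ℕ => (b : ℝ) ≤ T * B ∧ δ ≤ sy P y b)
  set S2 := (Ψ B).filter (fun b : ℕ => T * B < b)
  have hsub : Ψ B ⊆ Ey P y (Real.exp δ * B) ∪ S1 ∪ S2 := by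
    intro b hb
    have hb' := (hΨ B b).1 hb
    simp only [Finset.mem_union, S1, S2, Finset.mem_filter, hb, true_and]
    by_cases h2 : T * B < b
    · exact Or.inr h2
    by_cases h1 : δ ≤ sy P y b
    · exact Or.inl (Or.inr ⟨not_lt.1 h2, h1⟩)
    left; left
    rw [mem_Ey _ _ hP _ (by positivity)]
    refine ⟨hb'.1, ?_⟩
    have h0 : P * b ≠ 0 := (Nat.mul_pos hP hb'.1).ne'
    rw [← totient_mul_ffn (P * b)]
    have hF := Fy_pos P y b
    calc _ ≤ B * (Fy P y b * Real.exp (sy P y b)) := 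
          mul_le_mul hb'.2 (ffn_le_Fy P y b h0) (ffn_pos _).le hB.le
      _ ≤ B * (Fy P y b * Real.exp δ) := by
          gcongr
          exact (not_le.1 h1).le
      _ = _ := by ring
  have c1 : (S1.card : ℝ) ≤ 2 * (T * B) / (δ * (y - 1)) := by
    apply sy_count P p (ellp p) y hp hPd hy _ _ (by positivity) hδ
    intro b hb
    have hb := Finset.mem_filter.1 hb
    exact ⟨((hΨ B b).1 hb.1).1, hb.2⟩
  have c2 : (S2.card : ℝ) ≤ 8 * KK ^ 2 / T * B := by
    have : S2.card = (S2.image (P * ·)).card := by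
      rw [Finset.card_image_of_injective]
      intro a b h
      exact Nat.eq_of_mul_eq_mul_left hP h
    rw [this]
    apply tail_count _ B T hB hT
    intro n hn
    obtain ⟨b, hb, rfl⟩ := Finset.mem_image.1 hn
    have hb := Finset.mem_filter.1 hb
    refine ⟨lt_of_lt_of_le hb.2 ?_, ((hΨ B b).1 hb.1).2⟩
    exact_mod_cast Nat.le_mul_of_pos_left b hP
  have c3 := Finset.card_le_card hsub
  have c4 := Finset.card_union_le (Ey P y (Real.exp δ * B) ∪ S1) S2
  have c5 := Finset.card_union_le (Ey P y (Real.exp δ * B)) S1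
  have c6 : ((Ψ B).card : ℝ) ≤ (Ey P y (Real.exp δ * B)).card + S1.card + S2.card := by
    exact_mod_cast (by omega : (Ψ B).card ≤ (Ey P y (Real.exp δ * B)).card + S1.card + S2.card)
  linarith

lemma ap_pos (p : ℕ) (hp : p.Prime) : 0 < ap p := by
  have h2 : (2 : ℝ) ≤ p := by exact_mod_cast hp.two_le
  have := zetaR_one_le 2 (by norm_num)
  have := zetaR_one_le 3 (by norm_num)
  have := zetaR_one_le 6 (by norm_num)
  have : 0 < (p : ℝ) ^ 2 - p + 1 := by nlinarith
  unfold ap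
  positivity

theorem Psi_density (p : ℕ) (hp : p.Prime) (Ψ : ℝ → Finset ℕ)
    (hΨ : ∀ (B : ℝ) (b : ℕ), b ∈ Ψ B ↔ 1 ≤ b ∧ ((p ^ ellp p * b).totient : ℝ) ≤ B) : Tendsto (fun B : ℝ => ((Ψ B).card : ℝ) / B) atTop (nhds (ap p)) := by
  have hP : 0 < p ^ ellp p := pow_pos hp.pos _
  have hm := mean_tendsto (p ^ ellp p) p hp rfl
  set c : ℕ → ℝ := fun y => (1 / ((p ^ ellp p : ℕ) : ℝ)) * ∏ q ∈ y.primesBelow,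
      (if q = p then (q : ℝ) / (q - 1) else 1 + 1 / ((q : ℝ) * (q - 1))) with hc
  have hE : ∀ y, Tendsto (fun B : ℝ => ((Ey (p ^ ellp p) y B).card : ℝ) / B) atTop (nhds (c y)) := by
    intro y
    have := Ey_tendsto (p ^ ellp p) y hP
    rwa [Fy_mean (p ^ ellp p) p (ellp p) y hp (ellp_ne p) rfl] at this
  rw [tendsto_order]
  constructor
  · intro a ha
    obtain ⟨y, hy⟩ := (hm.eventually_const_lt ha).exists
    filter_upwards [(hE y).eventually_const_lt hy, eventually_gt_atTop 0] with B h1 hB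
    refine h1.trans_le ?_
    gcongr
    exact Psi_lower p hp Ψ hΨ y B hB.le
  · intro a ha
    -- choose T
    have hT : Tendsto (fun T : ℝ => ap p + 8 * KK ^ 2 / T) atTop (nhds (ap p + 0)) :=
      tendsto_const_nhds.add (tendsto_const_nhds.div_atTop tendsto_id)
    rw [add_zero] at hT
    obtain ⟨T, hT1, hT0⟩ := ((hT.eventually_lt_const ha).and (eventually_gt_atTop 0)).exists
    have hδ : Tendsto (fun δ : ℝ => Real.exp δ * ap p + 8 * KK ^ 2 / T) (nhdsWithin 0 (Set.Ioi 0))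
        (nhds (Real.exp 0 * ap p + 8 * KK ^ 2 / T)) := by
      apply Tendsto.mono_left _ nhdsWithin_le_nhds
      exact ((Real.continuous_exp.tendsto 0).mul_const _).add_const _
    rw [Real.exp_zero, one_mul] at hδ
    obtain ⟨δ, hδ1, hδ0⟩ := ((hδ.eventually_lt_const hT1).and self_mem_nhdsWithin).exists
    have hδ0 : 0 < δ := hδ0
    have hy : Tendsto (fun y : ℕ => Real.exp δ * c y + 2 * T / (δ * ((y : ℝ) - 1)) + 8 * KK ^ 2 / T) atTop
        (nhds (Real.exp δ * ap p + 0 + 8 * KK ^ 2 / T)) := by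
      refine ((hm.const_mul _).add ?_).add_const _
      apply tendsto_const_nhds.div_atTop
      apply Tendsto.const_mul_atTop hδ0
      exact tendsto_atTop_add_const_right _ (-1) tendsto_natCast_atTop_atTop
    rw [add_zero] at hy
    obtain ⟨y, hy1, hy0⟩ := ((hy.eventually_lt_const hδ1).and (eventually_gt_atTop p)).exists
    have hexp : Tendsto (fun B : ℝ => Real.exp δ * B) atTop atTop :=
      tendsto_id.const_mul_atTop (Real.exp_pos δ)
    have hlim := ((((hE y).comp hexp).const_mul (Real.exp δ)).add_const (2 * T / (δ * ((y : ℝ) - 1)))).add_const (8 * KK ^ 2 / T)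
    filter_upwards [hlim.eventually_lt_const hy1, eventually_gt_atTop 0] with B h1 hB
    refine lt_of_le_of_lt ?_ h1
    rw [div_le_iff₀ hB]
    refine (Psi_upper p hp Ψ hΨ y hy0 B δ T hB hδ0 hT0).trans (le_of_eq ?_)
    simp only [Function.comp]
    have := Real.exp_pos δ
    field_simp


lemma ap_lt_two (p : ℕ) (hp : p.Prime) : ap p < 2 := by
  have z2 : zetaR 2 ≤ 2 := by
    rw [zetaR_eq 2 le_rfl, hasSum_zeta_two.tsum_eq]
    nlinarith [Real.pi_lt_d2, Real.pi_pos]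
  have z3 : zetaR 3 ≤ zetaR 2 := by
    rw [zetaR_eq 2 le_rfl, zetaR_eq 3 (by norm_num)]
    apply (zetaR_summable 3 (by norm_num)).tsum_le_tsum _ (zetaR_summable 2 (by norm_num))
    intro n
    rcases Nat.eq_zero_or_pos n with rfl | hn
    · simp
    · have : (1 : ℝ) ≤ n := by exact_mod_cast hn
      apply one_div_le_one_div_of_le (by positivity)
      exact pow_le_pow_right₀ this (by norm_num)
  have a2 := zetaR_one_le 2 (by norm_num)
  have a3 := zetaR_one_le 3 (by norm_num)
  have a6 := zetaR_one_le 6 (by norm_num)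
  have hz : zetaR 2 * zetaR 3 / zetaR 6 ≤ 4 := by
    rw [div_le_iff₀ (by linarith)]
    nlinarith
  have hz0 : 0 ≤ zetaR 2 * zetaR 3 / zetaR 6 := by positivity
  have hd : (4 : ℝ) ≤ (p : ℝ) ^ ((ellp p : ℤ) - 2) * ((p : ℝ) ^ 2 - (p : ℝ) + 1) := by
    by_cases h5 : 5 ≤ p
    · have h : (5 : ℝ) ≤ p := by exact_mod_cast h5
      have : ellp p = 1 := by simp [ellp, h5]
      rw [this]
      norm_num
      rw [inv_mul_eq_div, le_div_iff₀ (by linarith)]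
      nlinarith
    · have h2 := hp.two_le
      have : p = 2 ∨ p = 3 ∨ p = 4 := by omega
      rcases this with rfl | rfl | rfl
      · norm_num [ellp]
      · norm_num [ellp]
      · exact absurd hp (by norm_num)
  have : 1 / ((p : ℝ) ^ ((ellp p : ℤ) - 2) * ((p : ℝ) ^ 2 - (p : ℝ) + 1)) ≤ 1 / 4 :=
    one_div_le_one_div_of_le (by norm_num) hd
  have h0 : 0 ≤ 1 / ((p : ℝ) ^ ((ellp p : ℤ) - 2) * ((p : ℝ) ^ 2 - (p : ℝ) + 1)) := by
    apply one_div_nonneg.2; linarith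
  unfold ap
  nlinarith

lemma S_nat (p : ℕ) (Ψ : ℝ → Finset ℕ)
    (hΨ : ∀ (B : ℝ) (b : ℕ), b ∈ Ψ B ↔ 1 ≤ b ∧ ((p ^ ellp p * b).totient : ℝ) ≤ B) (n : ℕ) :
    ∑ b ∈ Ψ n, ((p ^ ellp p * b).totient : ℝ) =
      n * ((Ψ n).card : ℝ) - ∑ m ∈ Finset.range n, ((Ψ m).card : ℝ) := by
  have h1 : ∀ m ∈ Finset.range n, ((Ψ m).card : ℝ) =
      ∑ b ∈ Ψ n, if (p ^ ellp p * b).totient ≤ m then (1 : ℝ) else 0 := by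
    intro m hm
    rw [← Finset.sum_filter, Finset.sum_const, nsmul_eq_mul, mul_one]
    congr 2
    ext b
    have hm := Finset.mem_range.1 hm
    simp only [Finset.mem_filter, hΨ, Nat.cast_le]
    constructor
    · rintro ⟨a, b⟩; exact ⟨⟨a, by omega⟩, b⟩
    · rintro ⟨⟨a, _⟩, b⟩; exact ⟨a, b⟩
  rw [Finset.sum_congr rfl h1, Finset.sum_comm, eq_sub_iff_add_eq, ← Finset.sum_add_distrib,
    mul_comm, ← nsmul_eq_mul, ← Finset.sum_const]
  apply Finset.sum_congr rfl
  intro b hb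
  have hb := ((hΨ _ _).1 hb).2
  rw [Nat.cast_le] at hb
  rw [← Finset.sum_filter, Finset.sum_const, nsmul_eq_mul, mul_one]
  have : (Finset.range n).filter (fun m => (p ^ ellp p * b).totient ≤ m) = Finset.Ico (p ^ ellp p * b).totient n := by
    ext m; simp [and_comm]
  rw [this, Nat.card_Ico, Nat.cast_sub hb]
  ring

lemma sum_N_tendsto (N : ℕ → ℝ) (a : ℝ) (h : Tendsto (fun n : ℕ => N n / n) atTop (nhds a)) :
    Tendsto (fun n : ℕ => (∑ m ∈ Finset.range n, N m) / (n : ℝ) ^ 2) atTop (nhds (a / 2)) := by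
  have hsum : ∀ n : ℕ, ∑ m ∈ Finset.range n, (m : ℝ) = n * (n - 1) / 2 := by
    intro n
    induction n with
    | zero => simp
    | succ k ih => rw [Finset.sum_range_succ, ih]; push_cast; ring
  have ho : (fun n : ℕ => N n - a * n) =o[atTop] (fun n : ℕ => (n : ℝ)) := by
    rw [Asymptotics.isLittleO_iff_tendsto']
    · have := h.sub_const a
      rw [sub_self] at this
      refine this.congr' ?_
      filter_upwards [eventually_gt_atTop 0] with n hn
      have : (n : ℝ) ≠ 0 := by exact_mod_cast hn.ne'
      field_simp
    · filter_upwards [eventually_gt_atTop 0] with n hn h0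
      exact absurd h0 (by exact_mod_cast hn.ne')
  have hinv : Tendsto (fun n : ℕ => (1 : ℝ) / n) atTop (nhds 0) := tendsto_one_div_atTop_nhds_zero_nat
  have hq : Tendsto (fun n : ℕ => ((n : ℝ) * (n - 1) / 2) / (n : ℝ) ^ 2) atTop (nhds (1 / 2)) := by
    have : Tendsto (fun n : ℕ => (1 - (1 : ℝ) / n) / 2) atTop (nhds ((1 - 0) / 2)) :=
      (hinv.const_sub 1).div_const 2
    rw [sub_zero] at this
    refine this.congr' ?_
    filter_upwards [eventually_gt_atTop 0] with n hn
    have : (n : ℝ) ≠ 0 := by exact_mod_cast hn.ne'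
    field_simp
  have hs := ho.sum_range (fun n => by simp) (by
    simp only [hsum]
    apply Tendsto.atTop_div_const (by norm_num)
    apply Tendsto.atTop_mul_atTop₀ tendsto_natCast_atTop_atTop
    exact tendsto_atTop_add_const_right _ (-1) tendsto_natCast_atTop_atTop)
  have hO : (fun n : ℕ => ∑ m ∈ Finset.range n, (m : ℝ)) =O[atTop] (fun n : ℕ => (n : ℝ) ^ 2) := by
    apply Asymptotics.IsBigO.of_bound 1
    filter_upwards [eventually_gt_atTop 0] with n hn
    rw [hsum]
    have : (1 : ℝ) ≤ n := by exact_mod_cast hn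
    rw [Real.norm_of_nonneg (by apply div_nonneg (mul_nonneg _ _) <;> linarith), Real.norm_of_nonneg (by positivity)]
    nlinarith
  have hs2 := (hs.trans_isBigO hO).tendsto_div_nhds_zero
  have := hs2.add (hq.const_mul a)
  rw [zero_add, mul_one_div] at this
  refine this.congr ?_
  intro n
  rw [Finset.sum_sub_distrib, ← Finset.mul_sum, hsum]
  ring

lemma S_tendsto (p : ℕ) (hp : p.Prime) (Ψ : ℝ → Finset ℕ)
    (hΨ : ∀ (B : ℝ) (b : ℕ), b ∈ Ψ B ↔ 1 ≤ b ∧ ((p ^ ellp p * b).totient : ℝ) ≤ B) :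
    Tendsto (fun B : ℝ => (∑ b ∈ Ψ B, ((p ^ ellp p * b).totient : ℝ)) / B ^ 2) atTop (nhds (ap p / 2)) := by
  have hd := Psi_density p hp Ψ hΨ
  have hdn : Tendsto (fun n : ℕ => ((Ψ n).card : ℝ) / n) atTop (nhds (ap p)) :=
    hd.comp tendsto_natCast_atTop_atTop
  have h1 := sum_N_tendsto _ _ hdn
  have h2 : Tendsto (fun n : ℕ => (∑ b ∈ Ψ n, ((p ^ ellp p * b).totient : ℝ)) / (n : ℝ) ^ 2) atTop
      (nhds (ap p / 2)) := by
    have := hdn.sub h1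
    rw [sub_half] at this
    refine this.congr' ?_
    filter_upwards [eventually_gt_atTop 0] with n hn
    have : (n : ℝ) ≠ 0 := by exact_mod_cast hn.ne'
    rw [S_nat p Ψ hΨ]
    field_simp
  have h3 : Tendsto (fun B : ℝ => (⌊B⌋₊ : ℝ) / B) atTop (nhds 1) := tendsto_nat_floor_div_atTop
  have h4 := (h2.comp tendsto_nat_floor_atTop).mul (h3.pow 2)
  rw [one_pow, mul_one] at h4
  refine h4.congr' ?_
  filter_upwards [eventually_ge_atTop 1] with B hB
  have hf : (⌊B⌋₊ : ℝ) ≠ 0 := by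
    have := Nat.floor_pos.2 hB
    exact_mod_cast this.ne'
  have hΨe : Ψ B = Ψ (⌊B⌋₊ : ℝ) := by
    ext b
    rw [hΨ, hΨ, Nat.cast_le, Nat.le_floor_iff (by linarith)]
  rw [hΨe]
  simp only [Function.comp]
  field_simp

lemma log_n_crude (n : ℕ) (hn : 0 < n) (B : ℝ) (hB : 0 < B) (h : (n.totient : ℝ) ≤ B) :
    (n : ℝ) ≤ 2 * B * (1 + Real.log n) := by
  rw [← totient_mul_ffn n]
  have h2 := (ffn_le_sgn n hn.ne').trans (mul_le_mul_of_nonneg_left (sgn_le_log n) (by norm_num))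
  rw [totient_mul_ffn n]
  calc (n : ℝ) = (n.totient : ℝ) * ffn n := (totient_mul_ffn n).symm
    _ ≤ B * (2 * (1 + Real.log n)) := mul_le_mul h h2 (ffn_pos n).le hB.le
    _ = _ := by ring

lemma log_n_crude2 (n : ℕ) (hn : 0 < n) (B : ℝ) (hB : 0 < B) (h : (n.totient : ℝ) ≤ B) :
    Real.log n ≤ Real.log 16 + 2 * Real.log B := by
  have hn0 : (0 : ℝ) < n := by exact_mod_cast hn
  have h1 := log_n_crude n hn B hB h
  have hs : 0 < √(n : ℝ) := Real.sqrt_pos.2 hn0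
  have hl : 1 + Real.log n ≤ 2 * √(n : ℝ) := by
    have := Real.log_le_sub_one_of_pos hs
    rw [Real.log_sqrt hn0.le] at this
    linarith
  have hsq : √(n : ℝ) * √(n : ℝ) = n := Real.mul_self_sqrt hn0.le
  have h2 : √(n : ℝ) ≤ 4 * B := by
    have : √(n : ℝ) * √(n : ℝ) ≤ 4 * B * √(n : ℝ) := by
      rw [hsq]
      calc _ ≤ _ := h1
        _ ≤ 2 * B * (2 * √(n : ℝ)) := by gcongr
        _ = _ := by ring
    exact le_of_mul_le_mul_right this hs
  have h3 : (n : ℝ) ≤ 16 * B ^ 2 := by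
    rw [← hsq]; nlinarith
  calc Real.log n ≤ Real.log (16 * B ^ 2) := Real.log_le_log hn0 h3
    _ = _ := by rw [Real.log_mul (by norm_num) (by positivity), Real.log_pow]; norm_num

lemma log_n_le (n : ℕ) (hn : 0 < n) (B : ℝ) (hB : 1 < B) (hB2 : 1 + Real.log 16 ≤ Real.log B) (h : (n.totient : ℝ) ≤ B) :
    Real.log n ≤ Real.log B + (Real.log 6 + Real.log (Real.log B)) := by
  have hn0 : (0 : ℝ) < n := by exact_mod_cast hn
  have hB0 : 0 < B := by linarith
  have hlB : 0 < Real.log B := Real.log_pos hB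
  have h1 := log_n_crude n hn B hB0 h
  have h2 := log_n_crude2 n hn B hB0 h
  have h3 : (n : ℝ) ≤ B * (6 * Real.log B) := by
    calc _ ≤ _ := h1
      _ ≤ 2 * B * (3 * Real.log B) := by gcongr; linarith
      _ = _ := by ring
  calc Real.log n ≤ Real.log (B * (6 * Real.log B)) := Real.log_le_log hn0 h3
    _ = _ := by rw [Real.log_mul hB0.ne' (by positivity), Real.log_mul (by norm_num) hlB.ne']

lemma h_bound (n : ℕ) (hn : 0 < n) (L : ℝ) (hL : 2 ≤ L) :
    ∑ q ∈ n.primeFactors, Real.log q / ((q : ℝ) - 1) ≤ Real.log L * (1 + Real.log L) + Real.log n / (L - 1) := by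
  have hlL : 0 ≤ Real.log L := Real.log_nonneg (by linarith)
  rw [← Finset.sum_filter_add_sum_filter_not _ (fun q : ℕ => (q : ℝ) ≤ L)]
  apply add_le_add
  · calc _ ≤ ∑ q ∈ n.primeFactors.filter (fun q : ℕ => (q : ℝ) ≤ L), Real.log L * ((q - 1 : ℕ) : ℝ)⁻¹ := by
          apply Finset.sum_le_sum
          intro q hq
          have hq := Finset.mem_filter.1 hq
          have h2 := two_le_of_mem_pf hq.1
          rw [div_eq_mul_inv, Nat.cast_sub (Nat.prime_of_mem_primeFactors hq.1).one_le, Nat.cast_one]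
          apply mul_le_mul_of_nonneg_right
          · exact Real.log_le_log (by linarith) hq.2
          · rw [inv_nonneg]; linarith
      _ = Real.log L * ∑ i ∈ (n.primeFactors.filter (fun q : ℕ => (q : ℝ) ≤ L)).image (fun q : ℕ => q - 1), ((i : ℕ) : ℝ)⁻¹ := by
          rw [Finset.sum_image, Finset.mul_sum]
          intro a ha b hb hab
          have ha := (Nat.prime_of_mem_primeFactors (Finset.mem_filter.1 ha).1).two_le
          have hb := (Nat.prime_of_mem_primeFactors (Finset.mem_filter.1 hb).1).two_le
          simp only at hab
          omega
      _ ≤ Real.log L * ∑ i ∈ Finset.Icc 1 ⌊L⌋₊, (i : ℝ)⁻¹ := by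
          gcongr
          intro i hi
          obtain ⟨q, hq, rfl⟩ := Finset.mem_image.1 hi
          have hq := Finset.mem_filter.1 hq
          have h2 := (Nat.prime_of_mem_primeFactors hq.1).two_le
          have h3 := Nat.le_floor hq.2
          rw [Finset.mem_Icc]
          omega
      _ ≤ _ := by
          gcongr
          have := harmonic_le_one_add_log ⌊L⌋₊
          rw [harmonic_eq_sum_Icc] at this
          push_cast at this
          refine this.trans ?_
          have hf : (0 : ℝ) < ⌊L⌋₊ := by
            have := Nat.floor_pos.2 (by linarith : 1 ≤ L)
            exact_mod_cast this
          linarith [Real.log_le_log hf (Nat.floor_le (by linarith : 0 ≤ L))]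
  · have hL1 : 0 < L - 1 := by linarith
    calc _ ≤ ∑ q ∈ n.primeFactors.filter (fun q : ℕ => ¬ (q : ℝ) ≤ L), Real.log q / (L - 1) := by
          apply Finset.sum_le_sum
          intro q hq
          have hq := Finset.mem_filter.1 hq
          have h2 := two_le_of_mem_pf hq.1
          have h3 := not_le.1 hq.2
          apply div_le_div_of_nonneg_left (Real.log_nonneg (by linarith)) hL1 (by linarith)
      _ ≤ ∑ q ∈ n.primeFactors, Real.log q / (L - 1) := by
          apply Finset.sum_le_sum_of_subset_of_nonneg (Finset.filter_subset _ _)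
          intro q hq _
          have h2 := two_le_of_mem_pf hq
          exact div_nonneg (Real.log_nonneg (by linarith)) hL1.le
      _ = (∑ q ∈ n.primeFactors, Real.log q) / (L - 1) := by rw [Finset.sum_div]
      _ ≤ _ := by
          gcongr
          rw [← Real.log_prod]
          · have h1 := Nat.le_of_dvd hn (Nat.prod_primeFactors_dvd n)
            have h2 : 0 < ∏ q ∈ n.primeFactors, q := Nat.pos_of_dvd_of_pos (Nat.prod_primeFactors_dvd n) hn
            apply Real.log_le_log
            · have : (0 : ℝ) < ((∏ q ∈ n.primeFactors, q : ℕ) : ℝ) := by exact_mod_cast h2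
              rwa [Nat.cast_prod] at this
            · have : ((∏ q ∈ n.primeFactors, q : ℕ) : ℝ) ≤ n := by exact_mod_cast h1
              rwa [Nat.cast_prod] at this
          · intro q hq
            have h2 := two_le_of_mem_pf hq
            linarith

lemma partB (p : ℕ) (hp : p.Prime) (Ψ : ℝ → Finset ℕ)
    (hΨ : ∀ (B : ℝ) (b : ℕ), b ∈ Ψ B ↔ 1 ≤ b ∧ ((p ^ ellp p * b).totient : ℝ) ≤ B) :
    ∀ᶠ B : ℝ in atTop, ∑ b ∈ Ψ B, ((p ^ ellp p * b).totient : ℝ) *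
          ∑ q ∈ (p ^ ellp p * b).primeFactors, Real.log q / ((q : ℝ) - 1)
        ≤ 10 * B ^ 2 * (Real.log (Real.log B)) ^ 2 := by
  have hd := (Psi_density p hp Ψ hΨ).eventually_lt_const (ap_lt_two p hp)
  have hll : Tendsto (fun B : ℝ => Real.log (Real.log B)) atTop atTop :=
    Real.tendsto_log_atTop.comp Real.tendsto_log_atTop
  filter_upwards [hd, eventually_gt_atTop 1, hll.eventually_ge_atTop 3,
    Real.tendsto_log_atTop.eventually_ge_atTop 2,
    Real.tendsto_log_atTop.eventually_ge_atTop (Real.log 16)] with B h1 hB h3 hL h16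
  have hB0 : 0 < B := by linarith
  rw [div_lt_iff₀ hB0] at h1
  set LL := Real.log (Real.log B)
  have hP : 0 < p ^ ellp p := pow_pos hp.pos _
  have hterm : ∀ b ∈ Ψ B, ((p ^ ellp p * b).totient : ℝ) *
      ∑ q ∈ (p ^ ellp p * b).primeFactors, Real.log q / ((q : ℝ) - 1) ≤ B * (LL * (1 + LL) + 6) := by
    intro b hb
    have hb := (hΨ B b).1 hb
    have hn : 0 < p ^ ellp p * b := Nat.mul_pos hP hb.1
    have h := h_bound _ hn (Real.log B) hL
    have hlog := log_n_crude2 _ hn B hB0 hb.2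
    have h6 : Real.log ((p ^ ellp p * b : ℕ) : ℝ) / (Real.log B - 1) ≤ 6 := by
      rw [div_le_iff₀ (by linarith)]
      linarith
    apply mul_le_mul hb.2 (by linarith) _ hB0.le
    apply Finset.sum_nonneg
    intro q hq
    have h2 := two_le_of_mem_pf hq
    exact div_nonneg (Real.log_nonneg (by linarith)) (by linarith)
  calc _ ≤ ∑ b ∈ Ψ B, B * (LL * (1 + LL) + 6) := Finset.sum_le_sum hterm
    _ = ((Ψ B).card : ℝ) * (B * (LL * (1 + LL) + 6)) := by rw [Finset.sum_const, nsmul_eq_mul]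
    _ ≤ (2 * B) * (B * (LL * (1 + LL) + 6)) := by gcongr
    _ ≤ (2 * B) * (B * (5 * LL ^ 2)) := by gcongr; nlinarith
    _ = _ := by ring

lemma partA (p : ℕ) (hp : p.Prime) (Ψ : ℝ → Finset ℕ)
    (hΨ : ∀ (B : ℝ) (b : ℕ), b ∈ Ψ B ↔ 1 ≤ b ∧ ((p ^ ellp p * b).totient : ℝ) ≤ B) :
    Tendsto (fun B : ℝ =>
        Real.log ((∏ b ∈ Ψ B, (p ^ ellp p * b) ^ (p ^ ellp p * b).totient : ℕ) : ℝ) /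
          (B ^ 2 * Real.log B))
      atTop (nhds (ap p / 2)) := by
  have hP : 0 < p ^ ellp p := pow_pos hp.pos _
  have hA : ∀ B, Real.log ((∏ b ∈ Ψ B, (p ^ ellp p * b) ^ (p ^ ellp p * b).totient : ℕ) : ℝ) =
      ∑ b ∈ Ψ B, ((p ^ ellp p * b).totient : ℝ) * Real.log ((p ^ ellp p * b : ℕ) : ℝ) := by
    intro B
    rw [Nat.cast_prod, Real.log_prod]
    · apply Finset.sum_congr rfl
      intro b _
      rw [Nat.cast_pow, Real.log_pow]
    · intro b hb
      have hn := Nat.mul_pos hP ((hΨ B b).1 hb).1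
      exact_mod_cast (pow_pos hn _).ne'
  simp only [hA]
  have hd := Psi_density p hp Ψ hΨ
  have hS := S_tendsto p hp Ψ hΨ
  set S : ℝ → ℝ := fun B => ∑ b ∈ Ψ B, ((p ^ ellp p * b).totient : ℝ) with hSdef
  have hlog := Real.tendsto_log_atTop
  have hinv : Tendsto (fun B : ℝ => 1 / Real.log B) atTop (nhds 0) := tendsto_const_nhds.div_atTop hlog
  have hll : Tendsto (fun B : ℝ => Real.log (Real.log B) / Real.log B) atTop (nhds 0) :=
    (Real.isLittleO_log_id_atTop.tendsto_div_nhds_zero).comp hlog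
  have hlow : Tendsto (fun B : ℝ => (1 - Real.log (Real.log B) / Real.log B) *
      (S B / B ^ 2 - (1 / Real.log B) * (((Ψ B).card : ℝ) / B))) atTop (nhds (ap p / 2)) := by
    have := (hll.const_sub 1).mul (hS.sub (hinv.mul hd))
    simpa using this
  have hup : Tendsto (fun B : ℝ => (1 + (Real.log 6 * (1 / Real.log B) + Real.log (Real.log B) / Real.log B)) *
      (S B / B ^ 2)) atTop (nhds (ap p / 2)) := by
    have := (((hinv.const_mul (Real.log 6)).add hll).const_add 1).mul hS
    simpa using this
  refine tendsto_of_tendsto_of_tendsto_of_le_of_le' hlow hup ?_ ?_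
  · filter_upwards [eventually_gt_atTop 1] with B hB
    have hB0 : 0 < B := by linarith
    have hl : 0 < Real.log B := Real.log_pos hB
    have hc : 0 ≤ Real.log B - Real.log (Real.log B) := by
      linarith [Real.log_le_sub_one_of_pos hl]
    rw [le_div_iff₀ (by positivity)]
    have : (1 - Real.log (Real.log B) / Real.log B) *
      (S B / B ^ 2 - (1 / Real.log B) * (((Ψ B).card : ℝ) / B)) * (B ^ 2 * Real.log B) =
      ∑ b ∈ Ψ B, (((p ^ ellp p * b).totient : ℝ) - B / Real.log B) * (Real.log B - Real.log (Real.log B)) := by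
      rw [← Finset.sum_mul, Finset.sum_sub_distrib, Finset.sum_const, nsmul_eq_mul]
      change _ = (S B - _) * _
      field_simp
    rw [this]
    apply Finset.sum_le_sum
    intro b hb
    have hb := (hΨ B b).1 hb
    have hn : 0 < p ^ ellp p * b := Nat.mul_pos hP hb.1
    have hn1 : (1 : ℝ) ≤ ((p ^ ellp p * b : ℕ) : ℝ) := by exact_mod_cast hn
    by_cases hcut : B / Real.log B ≤ ((p ^ ellp p * b).totient : ℝ)
    · apply mul_le_mul _ _ hc (Nat.cast_nonneg _)
      · have : 0 < B / Real.log B := by positivity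
        linarith
      · rw [← Real.log_div hB0.ne' hl.ne']
        apply Real.log_le_log (by positivity)
        exact hcut.trans (by exact_mod_cast Nat.totient_le _)
    · have h1 : (((p ^ ellp p * b).totient : ℝ) - B / Real.log B) * (Real.log B - Real.log (Real.log B)) ≤ 0 :=
        mul_nonpos_of_nonpos_of_nonneg (by linarith) hc
      exact h1.trans (mul_nonneg (Nat.cast_nonneg _) (Real.log_nonneg hn1))
  · filter_upwards [eventually_gt_atTop 1, hlog.eventually_ge_atTop (1 + Real.log 16)] with B hB h16
    have hB0 : 0 < B := by linarith
    have hl : 0 < Real.log B := Real.log_pos hB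
    rw [div_le_iff₀ (by positivity)]
    have : (1 + (Real.log 6 * (1 / Real.log B) + Real.log (Real.log B) / Real.log B)) *
      (S B / B ^ 2) * (B ^ 2 * Real.log B) =
      ∑ b ∈ Ψ B, ((p ^ ellp p * b).totient : ℝ) * (Real.log B + (Real.log 6 + Real.log (Real.log B))) := by
      rw [← Finset.sum_mul]
      change _ = S B * _
      field_simp
    rw [this]
    apply Finset.sum_le_sum
    intro b hb
    have hb := (hΨ B b).1 hb
    have hn : 0 < p ^ ellp p * b := Nat.mul_pos hP hb.1
    gcongr
    exact log_n_le _ hn B hB h16 hb.2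

/-- Lemma 7.3: with `Ψ B = Ψ_B` (given as a family of finite
sets characterised by the totient condition),
(a) `log A₁(B) = (a_p/2 + o(1)) B² log B`, and
(b) for all large `B`, `log A₂(B) ≤ 10 B² (log log B)²`, where
`log A₂(B) = ∑_{b ∈ Ψ_B} φ(p^{l_p} b) ∑_{q ∣ p^{l_p} b} (log q)/(q-1)`. -/
theorem log_A1_A2_estimates (p : ℕ) [Fact p.Prime]
    (Ψ : ℝ → Finset ℕ)
    (hΨ : ∀ (B : ℝ) (b : ℕ), b ∈ Ψ B ↔ 1 ≤ b ∧ ((p ^ ellp p * b).totient : ℝ) ≤ B) :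
    Tendsto (fun B : ℝ =>
        Real.log ((∏ b ∈ Ψ B, (p ^ ellp p * b) ^ (p ^ ellp p * b).totient : ℕ) : ℝ) /
          (B ^ 2 * Real.log B))
      atTop (nhds (ap p / 2)) ∧
    ∃ B₀ : ℝ, ∀ B : ℝ, B₀ ≤ B →
      ∑ b ∈ Ψ B, ((p ^ ellp p * b).totient : ℝ) *
          ∑ q ∈ (p ^ ellp p * b).primeFactors, Real.log q / ((q : ℝ) - 1)
        ≤ 10 * B ^ 2 * (Real.log (Real.log B)) ^ 2 := by
  have hp : p.Prime := Fact.out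
  exact ⟨partA p hp Ψ hΨ, eventually_atTop.1 (partB p hp Ψ hΨ)⟩
end
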